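/- Assume m ≥ 2, n ≥ 2, U ⊆ ℝ^m open and connected, H(u) = H0 + u1·H1 + ⋯ + um·Hm with H0,…,Hm Hermitian n×n complex matrices all having zero trace, and that the spectrum of H(·) is conically connected. Then every admissible trajectory of the lifted control system i·ġ(t) = H(u(t))·g(t) starting in the special unitary group SU(n) remains in SU(n), and the lifted system is exactly controllable in SU(n): for every g0 ∈ SU(n), its reachable set from g0 is all of SU(n). -/

import Mathlib

open scoped BigOperators

/-- The control-affine Hamiltonian `H(u) = H0 + u 1 • H1 + ⋯ + u m • Hm`. -/
noncomputable def controlHam {n m : ℕ} (H0 : Matrix (Fin n) (Fin n) ℂ)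
    (Hc : Fin m → Matrix (Fin n) (Fin n) ℂ) (u : EuclideanSpace ℝ (Fin m)) :
    Matrix (Fin n) (Fin n) ℂ :=
  H0 + ∑ i, (u i : ℂ) • Hc i

/-- `lam u 0 ≤ ⋯ ≤ lam u (n-1)` are the eigenvalues of `H(u)`, repeated according to
their multiplicities, for every `u ∈ U`:  `lam u` is monotone and the characteristic
polynomial of `H(u)` is `∏ j, (X - lam u j)`. -/
def IsOrderedSpectrum {n m : ℕ} (H0 : Matrix (Fin n) (Fin n) ℂ)
    (Hc : Fin m → Matrix (Fin n) (Fin n) ℂ) (U : Set (EuclideanSpace ℝ (Fin m)))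
    (lam : EuclideanSpace ℝ (Fin m) → Fin n → ℝ) : Prop :=
  ∀ u ∈ U, Monotone (lam u) ∧
    (controlHam H0 Hc u).charpoly = ∏ j, (Polynomial.X - Polynomial.C ((lam u j : ℂ)))

/-- The eigenvalue `lam ubar l` is a simple eigenvalue. -/
def SimpleEigAt {n m : ℕ} (lam : EuclideanSpace ℝ (Fin m) → Fin n → ℝ)
    (ubar : EuclideanSpace ℝ (Fin m)) (l : Fin n) : Prop :=
  ∀ l' : Fin n, lam ubar l' = lam ubar l → l' = l

/-- `ubar ∈ U` is a conical intersection between the (consecutive) eigenvalues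
`lam · j` and `lam · k`:  they coincide at `ubar`, the common value is an eigenvalue of
multiplicity two, and the gap opens at least linearly in every direction. -/
def ConicalAt {n m : ℕ} (U : Set (EuclideanSpace ℝ (Fin m)))
    (lam : EuclideanSpace ℝ (Fin m) → Fin n → ℝ) (j k : Fin n)
    (ubar : EuclideanSpace ℝ (Fin m)) : Prop :=
  ubar ∈ U ∧ lam ubar j = lam ubar k ∧
  (∀ l : Fin n, lam ubar l = lam ubar j ↔ (l = j ∨ l = k)) ∧
  ∃ c > (0 : ℝ), ∀ v : EuclideanSpace ℝ (Fin m), ‖v‖ = 1 →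
    ∃ ε > (0 : ℝ), ∀ t : ℝ, 0 < t → t < ε →
      lam (ubar + t • v) k - lam (ubar + t • v) j > c * t

/-- The spectrum is conically connected: every eigenvalue intersection is conical, and
every pair of subsequent eigenvalues admits a conical intersection at which all the
other eigenvalues are simple. -/
def ConicallyConnected {n m : ℕ} (U : Set (EuclideanSpace ℝ (Fin m)))
    (lam : EuclideanSpace ℝ (Fin m) → Fin n → ℝ) : Prop :=
  (∀ ubar ∈ U, ∀ j k : Fin n, (j : ℕ) + 1 = (k : ℕ) → lam ubar j = lam ubar k →
    ConicalAt U lam j k ubar) ∧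
  (∀ j k : Fin n, (j : ℕ) + 1 = (k : ℕ) → ∃ ubar : EuclideanSpace ℝ (Fin m),
    ConicalAt U lam j k ubar ∧ ∀ l : Fin n, l ≠ j → l ≠ k → SimpleEigAt lam ubar l)

attribute [local instance] Matrix.normedAddCommGroup Matrix.normedSpace

open MeasureTheory in
/-- A control `u : [0,T] → U` which is measurable and (essentially) bounded. -/
def IsAdmissibleControl {m : ℕ} (U : Set (EuclideanSpace ℝ (Fin m))) (T : ℝ)
    (u : ℝ → EuclideanSpace ℝ (Fin m)) : Prop :=
  AEStronglyMeasurable u (volume.restrict (Set.Icc 0 T)) ∧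
  (∀ t ∈ Set.Icc 0 T, u t ∈ U) ∧ ∃ C : ℝ, ∀ t ∈ Set.Icc 0 T, ‖u t‖ ≤ C

/-- An admissible trajectory of the lifted system `i·ġ(t) = H(u(t))·g(t)` on the
unitary group: an absolutely continuous curve in `U(n)` solving the equation almost
everywhere on `[0,T]`, encoded in integral form. -/
def IsLiftedTrajectory {n m : ℕ}
    (Hmat : EuclideanSpace ℝ (Fin m) → Matrix (Fin n) (Fin n) ℂ) (T : ℝ)
    (u : ℝ → EuclideanSpace ℝ (Fin m)) (g : ℝ → Matrix (Fin n) (Fin n) ℂ) : Prop :=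
  (∀ t ∈ Set.Icc 0 T, g t ∈ Matrix.unitaryGroup (Fin n) ℂ) ∧
  @IntervalIntegrable (Matrix (Fin n) (Fin n) ℂ)
    Matrix.normedAddCommGroup.toPseudoMetricSpace.toUniformSpace.toTopologicalSpace _
    (fun s => (-Complex.I) • (Hmat (u s) * g s))
    MeasureTheory.volume 0 T ∧
  ∀ t ∈ Set.Icc 0 T, g t = g 0 + ∫ s in (0:ℝ)..t, (-Complex.I) • (Hmat (u s) * g s)

/-- The reachable set from `g0` of the lifted system on the unitary group. -/
def liftedReachable {n m : ℕ} (U : Set (EuclideanSpace ℝ (Fin m)))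
    (Hmat : EuclideanSpace ℝ (Fin m) → Matrix (Fin n) (Fin n) ℂ)
    (g0 : Matrix (Fin n) (Fin n) ℂ) : Set (Matrix (Fin n) (Fin n) ℂ) :=
  {g1 | ∃ T : ℝ, 0 ≤ T ∧ ∃ u g, IsAdmissibleControl U T u ∧
    IsLiftedTrajectory Hmat T u g ∧ g 0 = g0 ∧ g T = g1}

/-- An admissible trajectory of the system `i·ψ̇(t) = H(u(t))·ψ(t)` on the unit sphere
of `ℂ^n`: an absolutely continuous curve in the sphere solving the equation almost
everywhere on `[0,T]`, encoded in integral form. -/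
def IsSphereTrajectory {n m : ℕ}
    (Hmat : EuclideanSpace ℝ (Fin m) → Matrix (Fin n) (Fin n) ℂ) (T : ℝ)
    (u : ℝ → EuclideanSpace ℝ (Fin m)) (ψ : ℝ → EuclideanSpace ℂ (Fin n)) : Prop :=
  (∀ t ∈ Set.Icc 0 T, ψ t ∈ Metric.sphere (0 : EuclideanSpace ℂ (Fin n)) 1) ∧
  IntervalIntegrable (fun s => (-Complex.I) • Matrix.toEuclideanLin (Hmat (u s)) (ψ s))
    MeasureTheory.volume 0 T ∧
  ∀ t ∈ Set.Icc 0 T,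
    ψ t = ψ 0 + ∫ s in (0:ℝ)..t, (-Complex.I) • Matrix.toEuclideanLin (Hmat (u s)) (ψ s)

/-- The reachable set from `ψ0` of the system on the unit sphere of `ℂ^n`. -/
def sphereReachable {n m : ℕ} (U : Set (EuclideanSpace ℝ (Fin m)))
    (Hmat : EuclideanSpace ℝ (Fin m) → Matrix (Fin n) (Fin n) ℂ)
    (ψ0 : EuclideanSpace ℂ (Fin n)) : Set (EuclideanSpace ℂ (Fin n)) :=
  {ψ1 | ∃ T : ℝ, 0 ≤ T ∧ ∃ u ψ, IsAdmissibleControl U T u ∧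
    IsSphereTrajectory Hmat T u ψ ∧ ψ 0 = ψ0 ∧ ψ T = ψ1}

section

attribute [local instance] Matrix.normedAddCommGroup Matrix.normedSpace

open NormedSpace Filter Topology

/-- Square complex matrices. -/
abbrev CMat (n : ℕ) := Matrix (Fin n) (Fin n) ℂ

instance instFirstCountableCMat (n : ℕ) : FirstCountableTopology (CMat n) :=
  inferInstanceAs (FirstCountableTopology (Fin n → Fin n → ℂ))

section MatCalculus
open scoped Matrix.Norms.L2Operator

theorem mat_exp_deriv {n : ℕ} (X : CMat n) (t : ℝ) :
    HasStrictDerivAt (fun t : ℝ => exp (t • X)) (exp (t • X) * X) t :=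
  hasStrictDerivAt_exp_smul_const X t

theorem mat_exp_deriv' {n : ℕ} (X : CMat n) (t : ℝ) :
    HasStrictDerivAt (fun t : ℝ => exp (t • X)) (X * exp (t • X)) t :=
  hasStrictDerivAt_exp_smul_const' X t

theorem mat_mul_deriv {n : ℕ} {f g : ℝ → CMat n} {f' g' : CMat n} {t : ℝ}
    (hf : HasStrictDerivAt f f' t) (hg : HasStrictDerivAt g g' t) :
    HasStrictDerivAt (fun t => f t * g t) (f' * g t + f t * g') t := hf.mul hg

theorem mat_mul_fderiv {n N : ℕ} {f g : (Fin N → ℝ) → CMat n}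
    {f' g' : (Fin N → ℝ) →L[ℝ] CMat n} {t : Fin N → ℝ}
    (hf : HasStrictFDerivAt f f' t) (hg : HasStrictFDerivAt g g' t) :
    ∃ D : (Fin N → ℝ) →L[ℝ] CMat n, HasStrictFDerivAt (fun t => f t * g t) D t ∧
      ∀ v, D v = f t * g' v + f' v * g t := by
  refine ⟨_, hf.mul' hg, fun v => ?_⟩
  simp

end MatCalculus

theorem mat_exp_unitary {n : ℕ} {X : CMat n} (hX : star X = -X) :
    exp X ∈ Matrix.unitaryGroup (Fin n) ℂ := by
  rw [Matrix.mem_unitaryGroup_iff, Matrix.star_eq_conjTranspose, ← Matrix.exp_conjTranspose,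
    ← Matrix.star_eq_conjTranspose, hX, ← Matrix.exp_add_of_commute _ _ ((Commute.refl X).neg_right)]
  simp

theorem mat_exp_star {n : ℕ} {X : CMat n} (hX : star X = -X) :
    star (exp X) = exp (-X) := by
  rw [Matrix.star_eq_conjTranspose, ← Matrix.exp_conjTranspose,
    ← Matrix.star_eq_conjTranspose, hX]

theorem skew_smul {n : ℕ} {X : CMat n} (hX : star X = -X) (t : ℝ) : star (t • X) = -(t • X) := by
  rw [star_smul, hX]; simp

theorem mat_exp_conj {n : ℕ} {g : CMat n} (hg : g ∈ Matrix.unitaryGroup (Fin n) ℂ) (X : CMat n) :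
    exp (g * X * star g) = g * exp X * star g := by
  have h1 := Matrix.mem_unitaryGroup_iff.1 hg
  have : star g = g⁻¹ := (Matrix.inv_eq_right_inv h1).symm
  rw [this]
  exact Matrix.exp_conj g X ((Matrix.isUnit_iff_isUnit_det g).2 (Matrix.isUnit_det_of_right_inverse h1))

/-- The semigroup generated by the flows. -/
def ctlS {n : ℕ} (XX : Set (CMat n)) : Submonoid (CMat n) :=
  Submonoid.closure {g | ∃ X ∈ XX, ∃ t : ℝ, 0 ≤ t ∧ g = exp (t • X)}

/-- Its closure. -/
def ctlG {n : ℕ} (XX : Set (CMat n)) : Set (CMat n) := closure (ctlS XX : Set (CMat n))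

/-- The span of all conjugates of the generators. -/
noncomputable def ctlL {n : ℕ} (XX : Set (CMat n)) : Submodule ℝ (CMat n) :=
  Submodule.span ℝ {A | ∃ g ∈ ctlG XX, ∃ X ∈ XX, A = g * X * star g}

theorem isClosed_unitaryGroup (n : ℕ) :
    IsClosed (Matrix.unitaryGroup (Fin n) ℂ : Set (CMat n)) := by
  have : (Matrix.unitaryGroup (Fin n) ℂ : Set (CMat n)) = {A | A * star A = 1} := by
    ext A; exact Matrix.mem_unitaryGroup_iff
  rw [this]
  exact isClosed_eq (by fun_prop) continuous_const

theorem isCompact_unitaryGroup (n : ℕ) :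
    IsCompact (Matrix.unitaryGroup (Fin n) ℂ : Set (CMat n)) := by
  have hc : IsCompact (Set.pi Set.univ (fun _ : Fin n => Set.pi Set.univ
      (fun _ : Fin n => Metric.closedBall (0 : ℂ) 1))) :=
    isCompact_univ_pi fun _ => isCompact_univ_pi fun _ => isCompact_closedBall _ _
  refine hc.of_isClosed_subset (isClosed_unitaryGroup n) ?_
  intro A hA i _ j _
  simpa using entry_norm_bound_of_unitary hA i j

variable {n : ℕ} {XX : Set (CMat n)}

theorem ctlS_unitary (hX : ∀ X ∈ XX, star X = -X) {g : CMat n} (hg : g ∈ ctlS XX) :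
    g ∈ Matrix.unitaryGroup (Fin n) ℂ := by
  have : ctlS XX ≤ Matrix.unitaryGroup (Fin n) ℂ := by
    refine Submonoid.closure_le.2 ?_
    rintro _ ⟨X, h, t, -, rfl⟩
    exact mat_exp_unitary (skew_smul (hX X h) t)
  exact this hg

theorem ctlG_unitary (hX : ∀ X ∈ XX, star X = -X) {g : CMat n} (hg : g ∈ ctlG XX) :
    g ∈ Matrix.unitaryGroup (Fin n) ℂ :=
  closure_minimal (fun _ h => ctlS_unitary hX h) (isClosed_unitaryGroup n) hg

theorem ctlG_compact (hX : ∀ X ∈ XX, star X = -X) : IsCompact (ctlG XX) :=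
  (isCompact_unitaryGroup n).of_isClosed_subset isClosed_closure fun _ h => ctlG_unitary hX h

theorem ctlS_sub {g : CMat n} (hg : g ∈ ctlS XX) : g ∈ ctlG XX := subset_closure hg

theorem ctlG_one : (1 : CMat n) ∈ ctlG XX := ctlS_sub (one_mem _)

theorem ctlG_mul {g h : CMat n} (hg : g ∈ ctlG XX) (hh : h ∈ ctlG XX) : g * h ∈ ctlG XX := by
  have := (ctlS XX).topologicalClosure.mul_mem (x := g) (y := h) hg hh
  exact this

theorem ctlG_star (hX : ∀ X ∈ XX, star X = -X) {g : CMat n} (hg : g ∈ ctlG XX) :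
    star g ∈ ctlG XX := by
  have key : ∀ g ∈ ctlS XX, star g ∈ ctlG XX := by
    intro g hg
    have hu := ctlS_unitary hX hg
    obtain ⟨a, ha, φ, hφ, hlim⟩ := (isCompact_unitaryGroup n).tendsto_subseq
      (x := fun k : ℕ => g ^ k) (fun k => pow_mem hu k)
    have h1 := Matrix.mem_unitaryGroup_iff.1 ha
    have hg1 := Matrix.mem_unitaryGroup_iff'.1 hu
    have hlim2 : Tendsto (fun k => star g * (g ^ φ (k+1) * star (g ^ φ k))) atTop
        (𝓝 (star g * (a * star a))) := by
      refine Tendsto.mul tendsto_const_nhds ?_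
      refine Tendsto.mul (hlim.comp (tendsto_add_atTop_nat 1)) ?_
      exact (continuous_star.tendsto a).comp hlim
    rw [h1, mul_one] at hlim2
    refine mem_closure_of_tendsto hlim2 (Eventually.of_forall fun k => ?_)
    have hlt : φ k < φ (k+1) := hφ (Nat.lt_succ_self k)
    obtain ⟨d, hd⟩ := Nat.exists_eq_add_of_lt hlt
    have e : star g * (g ^ φ (k+1) * star (g ^ φ k)) = g ^ d := by
      have h2 := Matrix.mem_unitaryGroup_iff.1 (pow_mem hu (φ k))
      rw [hd, show φ k + d + 1 = 1 + d + φ k by ring, pow_add, pow_add, pow_one]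
      calc star g * (g * g ^ d * g ^ φ k * star (g ^ φ k))
          = (star g * g) * g ^ d * (g ^ φ k * star (g ^ φ k)) := by noncomm_ring
        _ = _ := by rw [hg1, h2]; simp
    rw [e]
    exact pow_mem hg d
  have : Set.MapsTo (star : CMat n → CMat n) (ctlG XX) (closure (ctlG XX)) :=
    Set.MapsTo.closure (f := star) (fun g hg => key g hg) continuous_star
  have h := this hg
  rwa [ctlG, closure_closure] at h

theorem ctlG_exp (hX : ∀ X ∈ XX, star X = -X) {X : CMat n} (h : X ∈ XX) (t : ℝ) :
    exp (t • X) ∈ ctlG XX := by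
  have key : ∀ t : ℝ, 0 ≤ t → exp (t • X) ∈ ctlG XX := fun t ht =>
    ctlS_sub (Submonoid.subset_closure ⟨X, h, t, ht, rfl⟩)
  rcases le_total 0 t with ht | ht
  · exact key t ht
  · have := ctlG_star hX (key (-t) (by linarith))
    rw [mat_exp_star (skew_smul (hX X h) _)] at this
    simpa using this

theorem ctlL_closed : IsClosed (ctlL XX : Set (CMat n)) := Submodule.closed_of_finiteDimensional _

theorem ctlL_gen {X : CMat n} (h : X ∈ XX) : X ∈ ctlL XX :=
  Submodule.subset_span ⟨1, ctlG_one, X, h, by simp⟩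

theorem ctlL_skew (hX : ∀ X ∈ XX, star X = -X) {A : CMat n} (hA : A ∈ ctlL XX) :
    star A = -A := by
  induction hA using Submodule.span_induction with
  | mem x h =>
    obtain ⟨g, hg, X, hXX, rfl⟩ := h
    simp [hX X hXX, mul_assoc]
  | zero => simp
  | add x y _ _ hx hy => rw [star_add, hx, hy]; abel
  | smul a x _ hx => exact skew_smul hx a

theorem ctlL_conj {g A : CMat n} (hg : g ∈ ctlG XX) (hA : A ∈ ctlL XX) :
    g * A * star g ∈ ctlL XX := by
  induction hA using Submodule.span_induction with
  | mem x h =>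
    obtain ⟨g', hg', X, hXX, rfl⟩ := h
    exact Submodule.subset_span ⟨g * g', ctlG_mul hg hg', X, hXX, by simp [mul_assoc]⟩
  | zero => simp
  | add x y _ _ hx hy => rw [mul_add, add_mul]; exact add_mem hx hy
  | smul a x _ hx => simpa using (ctlL XX).smul_mem a hx

/-- derivative of a conjugation curve -/
theorem conj_curve_deriv {X : CMat n} (hX : star X = -X) (A : CMat n) :
    HasDerivAt (fun t : ℝ => exp (t • X) * A * star (exp (t • X))) (X * A - A * X) 0 := by
  have h1 := mat_exp_deriv X 0
  have h2 := mat_exp_deriv (-X) 0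
  have h3 := mat_mul_deriv (mat_mul_deriv h1 (hasStrictDerivAt_const (0:ℝ) A)) h2
  have h4 := h3.hasDerivAt
  have e : (fun t : ℝ => exp (t • X) * A * star (exp (t • X)))
      = fun t : ℝ => exp (t • X) * A * exp (t • (-X)) := by
    funext t
    rw [mat_exp_star (skew_smul hX t), smul_neg]
  have e2 : X * A - A * X = (exp ((0:ℝ) • X) * X * A + exp ((0:ℝ) • X) * 0) * exp ((0:ℝ) • -X)
      + exp ((0:ℝ) • X) * A * (exp ((0:ℝ) • -X) * -X) := by
    simp only [zero_smul, exp_zero, one_mul, mul_one, mul_zero, add_zero, mul_neg, sub_eq_add_neg]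
  rw [e, e2]
  exact h4

theorem ctlG_exp' (hX : ∀ X ∈ XX, star X = -X) {g X : CMat n} (hg : g ∈ ctlG XX) (h : X ∈ XX)
    (t : ℝ) : exp (t • (g * X * star g)) ∈ ctlG XX := by
  have : t • (g * X * star g) = g * (t • X) * star g := by simp
  rw [this, mat_exp_conj (ctlG_unitary hX hg)]
  exact ctlG_mul (ctlG_mul hg (ctlG_exp hX h t)) (ctlG_star hX hg)

theorem ctlL_bracket (hX : ∀ X ∈ XX, star X = -X) {A B : CMat n} (hA : A ∈ ctlL XX)
    (hB : B ∈ ctlL XX) : A * B - B * A ∈ ctlL XX := by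
  induction hA using Submodule.span_induction with
  | mem x h =>
    have hx : x ∈ ctlL XX := Submodule.subset_span h
    obtain ⟨g, hg, X, hXX, rfl⟩ := h
    have hd := conj_curve_deriv (ctlL_skew hX hx) B
    have := hd.tendsto_slope_zero
    refine ctlL_closed.mem_of_tendsto this (Eventually.of_forall fun t => ?_)
    refine (ctlL XX).smul_mem _ (sub_mem ?_ ?_)
    · exact ctlL_conj (ctlG_exp' hX hg hXX _) hB
    · exact ctlL_conj (ctlG_exp' hX hg hXX _) hB
  | zero => simp
  | add x y _ _ hx hy =>
    have : (x + y) * B - B * (x + y) = (x * B - B * x) + (y * B - B * y) := by noncomm_ring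
    rw [this]; exact add_mem hx hy
  | smul a x _ hx =>
    have : (a • x) * B - B * (a • x) = a • (x * B - B * x) := by simp [smul_sub]
    rw [this]; exact (ctlL XX).smul_mem a hx

theorem frob_trace {n : ℕ} (C : CMat n) :
    (C * star C).trace.re = ∑ i, ∑ j, ‖C i j‖ ^ 2 := by
  simp only [Matrix.trace, Matrix.diag, Matrix.mul_apply, Matrix.star_apply, Complex.re_sum]
  refine Finset.sum_congr rfl fun i _ => Finset.sum_congr rfl fun j _ => ?_
  rw [← Complex.normSq_eq_norm_sq, Complex.star_def, Complex.mul_conj, Complex.ofReal_re]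

/-- Trick of Hunt: an element of the Lie algebra can be conjugated so as to commute with another. -/
theorem hunt (hX : ∀ X ∈ XX, star X = -X) {A D : CMat n} (hA : A ∈ ctlL XX)
    (hD : D ∈ ctlL XX) : ∃ g ∈ ctlG XX, (g * A * star g) * D = D * (g * A * star g) ∧
      (A * star D).trace.re ≤ ((g * A * star g) * star D).trace.re := by
  obtain ⟨g, hg, hmax⟩ := (ctlG_compact hX).exists_isMaxOn ⟨1, ctlG_one⟩
    (f := fun g => ((g * A * star g) * star D).trace.re) (by
      apply Continuous.continuousOn
      have hc : Continuous (fun g : CMat n => (g * A * star g) * star D) :=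
        ((continuous_id.mul continuous_const).mul continuous_star).mul continuous_const
      exact Complex.continuous_re.comp hc.matrix_trace)
  refine ⟨g, hg, ?_, by simpa using hmax (ctlG_one (XX := XX))⟩
  set A' := g * A * star g with hA'
  have hA'L : A' ∈ ctlL XX := ctlL_conj hg hA
  have hDs := ctlL_skew hX hD
  have first : ∀ Y ∈ ctlL XX, ((Y * A' - A' * Y) * star D).trace.re = 0 := by
    intro Y hY
    induction hY using Submodule.span_induction with
    | mem x h =>
      have hx : x ∈ ctlL XX := Submodule.subset_span h
      obtain ⟨k, hk, X, hXX, rfl⟩ := h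
      have hd := conj_curve_deriv (ctlL_skew hX hx) A'
      let ell : CMat n →ₗ[ℝ] ℝ :=
        { toFun := fun M => (M * star D).trace.re
          map_add' := by intro a b; simp [add_mul]
          map_smul' := by intro a b; simp }
      have hd2 := (LinearMap.toContinuousLinearMap ell).hasFDerivAt.comp_hasDerivAt (0:ℝ) hd
      refine IsLocalMax.hasDerivAt_eq_zero ?_ hd2
      refine Eventually.of_forall fun t => ?_
      have := hmax (ctlG_mul (ctlG_exp' hX hk hXX t) hg)
      simp only [Set.mem_ofPred_eq] at this
      simp only [Function.comp, LinearMap.coe_toContinuousLinearMap', zero_smul, exp_zero, one_mul, star_one, mul_one]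
      simpa [ell, hA', mul_assoc] using this
    | zero => simp
    | add x y _ _ hx hy =>
      have : ((x + y) * A' - A' * (x + y)) * star D
        = (x * A' - A' * x) * star D + (y * A' - A' * y) * star D := by noncomm_ring
      rw [this, Matrix.trace_add, Complex.add_re, hx, hy, add_zero]
    | smul a x _ hx =>
      have : ((a • x) * A' - A' * (a • x)) * star D = a • ((x * A' - A' * x) * star D) := by
        simp [smul_sub, sub_mul]
      rw [this, Matrix.trace_smul, Complex.smul_re, hx, smul_zero]
  have hC := ctlL_bracket hX hA'L hD
  have hz := first _ hC
  have hCs := ctlL_skew hX hC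
  set C := A' * D - D * A' with hCdef
  have htr : ((C * A' - A' * C) * star D).trace = (C * star C).trace := by
    have e1 : (A' * C * D).trace = (C * (D * A')).trace := by
      rw [mul_assoc, Matrix.trace_mul_comm, mul_assoc]
    have e2 : (C * A' * D).trace = (C * (A' * D)).trace := by rw [mul_assoc]
    rw [hDs, hCs]
    simp only [mul_neg, sub_mul, Matrix.trace_neg, Matrix.trace_sub, e1, e2]
    rw [← Matrix.trace_sub, ← mul_sub, ← hCdef]
  rw [htr, frob_trace] at hz
  have hC0 : C = 0 := by
    have h0 : ∀ i, 0 ≤ ∑ j, ‖C i j‖ ^ 2 := fun i => Finset.sum_nonneg fun j _ => by positivity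
    ext i j
    have h1 := (Finset.sum_eq_zero_iff_of_nonneg (fun i _ => h0 i)).1 hz i (Finset.mem_univ i)
    have h2 := (Finset.sum_eq_zero_iff_of_nonneg
      (fun j _ => by positivity)).1 h1 j (Finset.mem_univ j)
    simpa using h2
  exact sub_eq_zero.1 hC0

end

section

attribute [local instance] Matrix.normedAddCommGroup Matrix.normedSpace

open NormedSpace Filter Topology

section ExpSurj

variable {n : ℕ}

theorem herm_diag {B : CMat n} (hB : B.IsHermitian) : ∃ Q ∈ Matrix.unitaryGroup (Fin n) ℂ,
    ∃ b : Fin n → ℝ, B = Q * Matrix.diagonal (fun i => (b i : ℂ)) * star Q := by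
  refine ⟨hB.eigenvectorUnitary, hB.eigenvectorUnitary.2, hB.eigenvalues, ?_⟩
  have := hB.spectral_theorem
  rw [Unitary.conjStarAlgAut_apply] at this
  exact this

theorem skew_diag {Y : CMat n} (hY : star Y = -Y) : ∃ Q ∈ Matrix.unitaryGroup (Fin n) ℂ,
    ∃ b : Fin n → ℝ, Y = Q * Matrix.diagonal (fun i => (b i : ℂ) * Complex.I) * star Q := by
  have hB : (-Complex.I • Y).IsHermitian := by
    rw [Matrix.IsHermitian, ← Matrix.star_eq_conjTranspose, star_smul, hY]; simp
  obtain ⟨Q, hQ, b, hb⟩ := herm_diag hB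
  refine ⟨Q, hQ, b, ?_⟩
  have e : Y = Complex.I • (-Complex.I • Y) := by simp [smul_smul]
  have e2 : Matrix.diagonal (fun i => (b i : ℂ) * Complex.I)
      = Complex.I • Matrix.diagonal (fun i => (b i : ℂ)) := by
    rw [← Matrix.diagonal_smul]; congr 1; funext i; simp [mul_comm]
  rw [e, hb, e2]
  simp

theorem exp_diag_conj {Q : CMat n} (hQ : Q ∈ Matrix.unitaryGroup (Fin n) ℂ) (d : Fin n → ℂ) :
    exp (Q * Matrix.diagonal d * star Q)
      = Q * Matrix.diagonal (fun i => Complex.exp (d i)) * star Q := by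
  rw [mat_exp_conj hQ, Matrix.exp_diagonal]
  congr 3
  funext i
  rw [Complex.exp_eq_exp_ℂ]
  exact Pi.coe_exp d i

theorem trace_conj {Q : CMat n} (hQ : Q ∈ Matrix.unitaryGroup (Fin n) ℂ) (D : CMat n) :
    (Q * D * star Q).trace = D.trace := by
  rw [Matrix.trace_mul_comm, ← mul_assoc, Matrix.mem_unitaryGroup_iff'.1 hQ, one_mul]

theorem det_conj' {Q : CMat n} (hQ : Q ∈ Matrix.unitaryGroup (Fin n) ℂ) (D : CMat n) :
    (Q * D * star Q).det = D.det := by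
  rw [Matrix.det_mul_comm, ← mul_assoc, Matrix.mem_unitaryGroup_iff'.1 hQ, one_mul]

theorem skew_det_exp {Y : CMat n} (hY : star Y = -Y) : (exp Y).det = Complex.exp Y.trace := by
  obtain ⟨Q, hQ, b, rfl⟩ := skew_diag hY
  rw [exp_diag_conj hQ, det_conj' hQ, trace_conj hQ, Matrix.det_diagonal, Matrix.trace_diagonal,
    Complex.exp_sum]

section
open scoped Matrix.Norms.L2Operator
theorem exp_surj_aux {u : CMat n} (hu : u ∈ Matrix.unitaryGroup (Fin n) ℂ)
    (h : (-1 : ℂ) ∉ spectrum ℂ u) : ∃ B : CMat n, B.IsHermitian ∧ exp (Complex.I • B) = u := by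
  have h2 := (Unitary.norm_sub_one_lt_two_iff (A := CMat n) hu).2 h
  have h3 := expUnitary_argSelfAdjoint (A := CMat n) (u := ⟨u, hu⟩) h2
  refine ⟨(Unitary.argSelfAdjoint (A := CMat n) ⟨u, hu⟩ : selfAdjoint (CMat n)).1,
    (Unitary.argSelfAdjoint (A := CMat n) ⟨u, hu⟩ : selfAdjoint (CMat n)).2, ?_⟩
  have h4 := congrArg Subtype.val h3
  exact h4
end

theorem exists_rot (u : CMat n) : ∃ θ : ℝ,
    (-1 : ℂ) ∉ spectrum ℂ (Complex.exp (θ * Complex.I) • u) := by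
  have hfin := Matrix.finite_spectrum u
  have hinj : Set.InjOn (fun θ : ℝ => -Complex.exp (-(θ * Complex.I))) (Set.Ioo (-Real.pi) Real.pi) := by
    intro x hx y hy hxy
    have h1 : Complex.exp (((-x : ℝ) : ℂ) * Complex.I) = Complex.exp (((-y : ℝ) : ℂ) * Complex.I) := by
      have := neg_injective hxy
      simpa using this
    have h2 := congrArg Complex.arg h1
    rw [Complex.arg_exp_mul_I, Complex.arg_exp_mul_I,
      (toIocMod_eq_self Real.two_pi_pos).2 ⟨by linarith [hx.2], by linarith [hx.1, Real.pi_pos]⟩,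
      (toIocMod_eq_self Real.two_pi_pos).2 ⟨by linarith [hy.2], by linarith [hy.1, Real.pi_pos]⟩] at h2
    linarith
  have hI : (Set.Ioo (-Real.pi) Real.pi).Infinite := Set.Ioo_infinite (by linarith [Real.pi_pos])
  have hII := (hI.image hinj)
  obtain ⟨z, ⟨θ, hθ, rfl⟩, hz⟩ := hII.exists_notMem_finite hfin
  refine ⟨θ, fun h => hz ?_⟩
  have hne : Complex.exp (θ * Complex.I) ≠ 0 := Complex.exp_ne_zero _
  have := (spectrum.smul_mem_smul_iff (R := ℂ) (a := u) (s := -Complex.exp (-(θ * Complex.I)))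
    (r := Units.mk0 _ hne)).1
  apply this
  have e : (Units.mk0 _ hne) • (-Complex.exp (-(θ * Complex.I))) = (-1 : ℂ) := by
    rw [Units.smul_def]
    simp [← Complex.exp_add]
  rw [e]
  exact h

theorem exp_surj (hn : 0 < n) {g : CMat n} (hg : g ∈ Matrix.specialUnitaryGroup (Fin n) ℂ) :
    ∃ Y : CMat n, star Y = -Y ∧ Y.trace = 0 ∧ exp Y = g := by
  obtain ⟨hgu, hgd⟩ := Matrix.mem_specialUnitaryGroup_iff.1 hg
  obtain ⟨θ, hθ⟩ := exists_rot g
  have hu : Complex.exp (θ * Complex.I) • g ∈ Matrix.unitaryGroup (Fin n) ℂ := by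
    rw [Matrix.mem_unitaryGroup_iff, star_smul, smul_mul_smul_comm,
      Matrix.mem_unitaryGroup_iff.1 hgu, Complex.star_def, ← Complex.exp_conj, ← Complex.exp_add]
    simp
  obtain ⟨B, hB, hBe⟩ := exp_surj_aux hu hθ
  obtain ⟨Q, hQ, b, rfl⟩ := herm_diag hB
  have e1 : Complex.I • (Q * Matrix.diagonal (fun i => (b i : ℂ)) * star Q)
      = Q * Matrix.diagonal (fun i => Complex.I * (b i : ℂ)) * star Q := by
    rw [← smul_mul_assoc, ← mul_smul_comm, ← Matrix.diagonal_smul]; rfl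
  rw [e1, exp_diag_conj hQ] at hBe
  have hg2 : g = Q * Matrix.diagonal (fun i => Complex.exp (((b i - θ : ℝ) : ℂ) * Complex.I)) * star Q := by
    have : g = Complex.exp (-(θ * Complex.I)) • (Complex.exp (θ * Complex.I) • g) := by
      rw [smul_smul, ← Complex.exp_add]; simp
    rw [this, ← hBe, ← smul_mul_assoc, ← mul_smul_comm, ← Matrix.diagonal_smul]
    congr 3
    funext i
    simp only [Pi.smul_apply, smul_eq_mul, ← Complex.exp_add]
    congr 1; push_cast; ring
  have hdet : Complex.exp (((∑ i, (b i - θ) : ℝ) : ℂ) * Complex.I) = 1 := by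
    rw [← hgd, hg2, det_conj' hQ, Matrix.det_diagonal, ← Complex.exp_sum]
    push_cast; rw [Finset.sum_mul]
  obtain ⟨k, hk⟩ := Complex.exp_eq_one_iff.1 hdet
  have hk' : (∑ i, (b i - θ) : ℝ) = k * (2 * Real.pi) := by
    have : (((∑ i, (b i - θ) : ℝ) : ℂ)) * Complex.I = ((k * (2 * Real.pi) : ℝ) : ℂ) * Complex.I := by
      rw [hk]; push_cast; ring
    exact_mod_cast mul_right_cancel₀ Complex.I_ne_zero this
  let i0 : Fin n := ⟨0, hn⟩
  let a : Fin n → ℝ := fun i => (b i - θ) - if i = i0 then k * (2 * Real.pi) else 0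
  have ha : ∑ i, a i = 0 := by
    simp only [a, Finset.sum_sub_distrib, Finset.sum_ite_eq', Finset.mem_univ, if_true] at hk' ⊢
    rw [hk']; ring
  refine ⟨Q * Matrix.diagonal (fun i => (a i : ℂ) * Complex.I) * star Q, ?_, ?_, ?_⟩
  · simp only [star_mul, star_star, Matrix.star_eq_conjTranspose, Matrix.conjTranspose_mul,
      Matrix.diagonal_conjTranspose, Matrix.conjTranspose_conjTranspose]
    rw [← mul_assoc, ← neg_mul, ← mul_neg, Matrix.diagonal_neg]
    congr 3
    funext i
    simp
  · rw [trace_conj hQ, Matrix.trace_diagonal, ← Finset.sum_mul]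
    have : (∑ i, (a i : ℂ)) = 0 := by exact_mod_cast ha
    rw [this, zero_mul]
  · rw [exp_diag_conj hQ, hg2]
    congr 3
    funext i
    simp only [a]
    split_ifs with hi
    · rw [Complex.exp_eq_exp_iff_exists_int]
      refine ⟨-k, ?_⟩
      push_cast; ring
    · simp

end ExpSurj

end

section

attribute [local instance] Matrix.normedAddCommGroup Matrix.normedSpace

open NormedSpace Filter Topology

section MatCalculus2
open scoped Matrix.Norms.L2Operator

theorem mat_mul_fderivV {n : ℕ} {W : Type*} [NormedAddCommGroup W] [NormedSpace ℝ W]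
    {f g : W → CMat n} {f' g' : W →L[ℝ] CMat n} {t : W}
    (hf : HasStrictFDerivAt f f' t) (hg : HasStrictFDerivAt g g' t) :
    ∃ D : W →L[ℝ] CMat n, HasStrictFDerivAt (fun t => f t * g t) D t ∧
      ∀ v, D v = f t * g' v + f' v * g t := by
  refine ⟨_, hf.mul' hg, fun v => ?_⟩
  simp

theorem mat_exp_fderivV {n : ℕ} {W : Type*} [NormedAddCommGroup W] [NormedSpace ℝ W]
    (ell : W →L[ℝ] ℝ) (X : CMat n) (t : W) :
    ∃ D : W →L[ℝ] CMat n, HasStrictFDerivAt (fun t => exp (ell t • X)) D t ∧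
      ∀ v, D v = ell v • (X * exp (ell t • X)) := by
  have h1 : HasStrictDerivAt (fun s : ℝ => exp (s • X)) (X * exp (ell t • X)) (ell t) :=
    hasStrictDerivAt_exp_smul_const' X (ell t)
  have h2 := h1.hasStrictFDerivAt.comp t ell.hasStrictFDerivAt
  refine ⟨_, h2, fun v => ?_⟩
  simp

end MatCalculus2

section Krener

variable {n : ℕ} {XX : Set (CMat n)}

/-- Parametrized families of elements of the semigroup, whose derivative covers `E`. -/
def KPred (XX : Set (CMat n)) (E : Submodule ℝ (CMat n)) : Prop :=
  ∃ (V : Type) (_ : NormedAddCommGroup V) (_ : NormedSpace ℝ V) (_ : CompleteSpace V)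
    (p : V → CMat n) (t0 : V) (D : V →L[ℝ] CMat n),
    (∀ᶠ t in 𝓝 t0, p t ∈ ctlS XX) ∧ HasStrictFDerivAt p D t0 ∧ ∀ Y ∈ E, ∃ v, D v = Y * p t0

theorem kpred_bot : KPred XX ⊥ := by
  refine ⟨ℝ, inferInstance, inferInstance, inferInstance, fun _ => 1, 0, 0, ?_, ?_, ?_⟩
  · exact Eventually.of_forall fun _ => one_mem _
  · exact hasStrictFDerivAt_const _ _
  · intro Y hY
    refine ⟨0, ?_⟩
    rw [Submodule.mem_bot] at hY
    simp [hY]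

theorem kpred_step (hX : ∀ X ∈ XX, star X = -X) {E : Submodule ℝ (CMat n)} (hE : KPred XX E)
    (hL : ¬ ctlL XX ≤ E) : ∃ E', E < E' ∧ KPred XX E' := by
  obtain ⟨V, i1, i2, i3, p, t0, D, hS, hD, hsur⟩ := hE
  have hq : p t0 ∈ ctlS XX := hS.self_of_nhds
  set q := p t0 with hqdef
  have hqu := ctlS_unitary hX hq
  have hqs : star q * q = 1 := Matrix.mem_unitaryGroup_iff'.1 hqu
  have hqs' : q * star q = 1 := Matrix.mem_unitaryGroup_iff.1 hqu
  have : ∃ r ∈ ctlS XX, ∃ X ∈ XX, (q * r) * X * star (q * r) ∉ E := by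
    by_contra hcon
    push Not at hcon
    apply hL
    refine Submodule.span_le.2 ?_
    rintro _ ⟨g, hg, X, hXX, rfl⟩
    have hcl : IsClosed {r : CMat n | (q * r) * X * star (q * r) ∈ E} := by
      have hEc : IsClosed (E : Set (CMat n)) := Submodule.closed_of_finiteDimensional _
      exact hEc.preimage (f := fun r : CMat n => (q * r) * X * star (q * r)) (by fun_prop)
    have h1 : ctlG XX ⊆ {r : CMat n | (q * r) * X * star (q * r) ∈ E} :=
      closure_minimal (fun r hr => hcon r hr X hXX) hcl
    have h2 := h1 (ctlG_mul (ctlG_star hX (ctlS_sub hq)) hg)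
    have e : q * (star q * g) = g := by rw [← mul_assoc, hqs', one_mul]
    simp only [Set.mem_ofPred_eq, e] at h2
    exact h2
  obtain ⟨r, hr, X, hXX, hY⟩ := this
  have hru := ctlS_unitary hX hr
  have hrs : star r * r = 1 := Matrix.mem_unitaryGroup_iff'.1 hru
  set Y := (q * r) * X * star (q * r) with hYdef
  refine ⟨E ⊔ Submodule.span ℝ {Y}, ?_, ?_⟩
  · refine lt_of_le_of_ne le_sup_left fun h => hY ?_
    rw [h]
    exact Submodule.mem_sup_right (Submodule.mem_span_singleton_self Y)
  have h1 : HasStrictFDerivAt (fun x : V × ℝ => p x.1) (D.comp (ContinuousLinearMap.fst ℝ V ℝ)) (t0, 1) :=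
    HasStrictFDerivAt.comp (t0, (1:ℝ)) (g := p) (f := Prod.fst) hD hasStrictFDerivAt_fst
  have h2 : HasStrictFDerivAt (fun x : V × ℝ => r) (0 : V × ℝ →L[ℝ] CMat n) (t0, 1) :=
    hasStrictFDerivAt_const _ _
  obtain ⟨D3, h3, hD3⟩ := mat_exp_fderivV (ContinuousLinearMap.snd ℝ V ℝ) X (t0, (1:ℝ))
  obtain ⟨D4, h4, hD4⟩ := mat_mul_fderivV h1 h2
  obtain ⟨D5, h5, hD5⟩ := mat_mul_fderivV h4 h3
  refine ⟨V × ℝ, inferInstance, inferInstance, inferInstance, _, (t0, 1), D5, ?_, h5, ?_⟩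
  · have hev : ∀ᶠ x : V × ℝ in 𝓝 (t0, 1), p x.1 ∈ ctlS XX ∧ 0 < x.2 := by
      rw [nhds_prod_eq]
      exact (hS.prod_mk (lt_mem_nhds (by norm_num : (0:ℝ) < 1)))
    filter_upwards [hev] with x hx
    refine mul_mem (mul_mem hx.1 hr) (Submonoid.subset_closure ⟨X, hXX, x.2, hx.2.le, rfl⟩)
  · intro Z hZ
    obtain ⟨Z1, hZ1, Z2, hZ2, rfl⟩ := Submodule.mem_sup.1 hZ
    obtain ⟨c, rfl⟩ := Submodule.mem_span_singleton.1 hZ2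
    obtain ⟨v, hv⟩ := hsur Z1 hZ1
    refine ⟨(v, c), ?_⟩
    rw [hD5, hD4, hD3]
    simp only [ContinuousLinearMap.coe_snd', ContinuousLinearMap.comp_apply, ContinuousLinearMap.coe_fst', one_smul,
      _root_.zero_apply, mul_zero, zero_add, ← hqdef, hv]
    have e : Y * (q * r * exp X) = q * r * (X * exp X) := by
      rw [hYdef, star_mul]
      calc q * r * X * (star r * star q) * (q * r * exp X)
          = q * r * X * (star r * (star q * q) * r) * exp X := by noncomm_ring
        _ = _ := by rw [hqs, mul_one, hrs]; noncomm_ring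
    rw [add_mul, smul_mul_assoc, e, mul_smul_comm, add_comm]
    simp only [mul_assoc]

theorem kpred_full (hX : ∀ X ∈ XX, star X = -X) : ∃ E, ctlL XX ≤ E ∧ KPred XX E := by
  obtain ⟨E, hE, hmax⟩ := (wellFounded_gt (α := Submodule ℝ (CMat n))).has_min
    {E | KPred XX E} ⟨⊥, kpred_bot⟩
  refine ⟨E, ?_, hE⟩
  by_contra h
  obtain ⟨E', h1, h2⟩ := kpred_step hX hE h
  exact hmax E' h2 h1

theorem ctlS_special (hX : ∀ X ∈ XX, star X = -X) (htr : ∀ X ∈ XX, X.trace = 0) {g : CMat n}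
    (hg : g ∈ ctlS XX) : g ∈ Matrix.specialUnitaryGroup (Fin n) ℂ := by
  have : ctlS XX ≤ Matrix.specialUnitaryGroup (Fin n) ℂ := by
    refine Submonoid.closure_le.2 ?_
    rintro _ ⟨X, h, t, -, rfl⟩
    refine Matrix.mem_specialUnitaryGroup_iff.2 ⟨mat_exp_unitary (skew_smul (hX X h) t), ?_⟩
    rw [skew_det_exp (skew_smul (hX X h) t), Matrix.trace_smul, htr X h, smul_zero, Complex.exp_zero]
  exact this hg

theorem local_open (hn : 0 < n) (hX : ∀ X ∈ XX, star X = -X) (htr : ∀ X ∈ XX, X.trace = 0)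
    (hfull : ∀ Y : CMat n, star Y = -Y → Y.trace = 0 → Y ∈ ctlL XX) :
    ∃ q ∈ ctlS XX, ∀ᶠ g in 𝓝 q, g ∈ Matrix.specialUnitaryGroup (Fin n) ℂ → g ∈ ctlS XX := by
  obtain ⟨E, hLE, V, i1, i2, i3, p, t0, D, hS, hD, hsur⟩ := kpred_full hX
  have hq : p t0 ∈ ctlS XX := hS.self_of_nhds
  refine ⟨p t0, hq, ?_⟩
  set q := p t0 with hqdef
  have hqu := ctlS_unitary hX hq
  have hqs : star q * q = 1 := Matrix.mem_unitaryGroup_iff'.1 hqu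
  have hqs' : q * star q = 1 := Matrix.mem_unitaryGroup_iff.1 hqu
  let J : CMat n := Complex.I • 1
  have hJ : star J = -J := by simp [J]
  let x0 : V × (CMat n × ℝ) := (t0, 0, 0)
  have h1 : HasStrictFDerivAt (fun x : V × (CMat n × ℝ) => p x.1)
      (D.comp (ContinuousLinearMap.fst ℝ V (CMat n × ℝ))) x0 :=
    HasStrictFDerivAt.comp x0 (g := p) (f := Prod.fst) hD hasStrictFDerivAt_fst
  let ell : (V × (CMat n × ℝ)) →L[ℝ] ℝ :=
    (ContinuousLinearMap.snd ℝ (CMat n) ℝ).comp (ContinuousLinearMap.snd ℝ V (CMat n × ℝ))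
  obtain ⟨D3, h3, hD3⟩ := mat_exp_fderivV ell J x0
  let symm0 : CMat n →ₗ[ℝ] CMat n :=
    { toFun := fun B => B + star B
      map_add' := by intro a b; simp only [star_add]; abel
      map_smul' := by intro a b; simp }
  let mid : (V × (CMat n × ℝ)) →L[ℝ] CMat n := (LinearMap.toContinuousLinearMap symm0).comp
    ((ContinuousLinearMap.fst ℝ (CMat n) ℝ).comp (ContinuousLinearMap.snd ℝ V (CMat n × ℝ)))
  have h2 : HasStrictFDerivAt (fun x : V × (CMat n × ℝ) => 1 + mid x) mid x0 :=
    mid.hasStrictFDerivAt.const_add 1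
  obtain ⟨D4, h4, hD4⟩ := mat_mul_fderivV h1 h2
  obtain ⟨D5, h5, hD5⟩ := mat_mul_fderivV h4 h3
  have hD5' : ∀ v : V × (CMat n × ℝ), D5 v = q * (1 + ((0 : CMat n) + star 0)) *
      (v.2.2 • (J * exp ((0:ℝ) • J))) + (q * (v.2.1 + star v.2.1) +
      D v.1 * (1 + ((0 : CMat n) + star 0))) * exp ((0:ℝ) • J) := by
    intro v
    have e1 := hD5 v
    have e2 := hD4 v
    have e3 := hD3 v
    rw [e2, e3] at e1
    exact e1
  have h5' : HasStrictFDerivAt (fun x : V × (CMat n × ℝ) =>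
    p x.1 * (1 + (x.2.1 + star x.2.1)) * exp (x.2.2 • J)) D5 x0 := h5
  have mid0 : mid x0 = 0 := by simp [mid, x0]
  have ell0 : ell x0 = 0 := by simp [ell, x0]
  have hrange : D5.range = ⊤ := by
    refine LinearMap.range_eq_top.2 fun M => ?_
    set W := star q * M with hW
    let K : CMat n := (1/2 : ℝ) • (W - star W)
    have hK : star K = -K := by
      simp only [K, star_smul, star_sub, star_star, ← smul_neg, neg_sub]; simp
    have hKtr : ∃ τ : ℝ, K.trace = τ * Complex.I := by
      have : star K.trace = - K.trace := by
        rw [← Matrix.trace_conjTranspose, ← Matrix.star_eq_conjTranspose, hK, Matrix.trace_neg]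
      refine ⟨K.trace.im, ?_⟩
      apply Complex.ext
      · have := congrArg Complex.re this
        simp at this
        simp; linarith
      · simp
    obtain ⟨τ, hτ⟩ := hKtr
    let K0 : CMat n := K - (τ / n : ℝ) • J
    have hK0 : star K0 = -K0 := by
      simp only [K0, star_sub, hK, skew_smul hJ]; abel
    have hK0tr : K0.trace = 0 := by
      have hn' : (n : ℂ) ≠ 0 := by exact_mod_cast hn.ne'
      simp only [K0, J, Matrix.trace_sub, Matrix.trace_smul, hτ, Matrix.trace_one, Fintype.card_fin,
        Complex.real_smul, smul_eq_mul]
      push_cast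
      field_simp
      ring
    have hmem : q * K0 * star q ∈ E := by
      apply hLE
      apply hfull
      · simp [hK0, mul_assoc]
      · rw [trace_conj hqu, hK0tr]
    obtain ⟨v, hv⟩ := hsur _ hmem
    refine ⟨(v, (1/4 : ℝ) • (W + star W), τ / n), ?_⟩
    change D5 _ = M
    rw [hD5']
    have hv' : D v = q * K0 := by rw [hv, mul_assoc, hqs, mul_one]
    simp only [zero_smul, exp_zero, mul_one, add_zero, star_zero, hv']
    have e1 : (1/4 : ℝ) • (W + star W) + star ((1/4 : ℝ) • (W + star W)) = (1/2 : ℝ) • (W + star W) := by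
      simp only [star_smul, star_add, star_star, add_comm (star W) W]
      rw [star_trivial (1/4 : ℝ), ← add_smul]; norm_num
    rw [e1, ← mul_add, ← mul_add]
    have e3 : (τ / n : ℝ) • J + ((1/2 : ℝ) • (W + star W) + K0) = W := by
      simp only [K0, K]
      have : (1/2 : ℝ) • W + (1/2 : ℝ) • W = W := by rw [← add_smul]; norm_num
      rw [smul_add, smul_sub]
      calc _ = (1/2 : ℝ) • W + (1/2 : ℝ) • W := by abel
        _ = W := this
    rw [e3, hW, ← mul_assoc, hqs', one_mul]
  have hmap := h5'.map_nhds_eq_of_surj hrange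
  have hF0 : p x0.1 * (1 + (x0.2.1 + star x0.2.1)) * exp (x0.2.2 • J) = q := by
    simp [x0, hqdef]
  have hmap' : map (fun x : V × (CMat n × ℝ) =>
    p x.1 * (1 + (x.2.1 + star x.2.1)) * exp (x.2.2 • J)) (𝓝 x0) = 𝓝 q := by
    rw [← hF0]; exact hmap
  rw [← hmap', eventually_map]
  have c1 : ∀ᶠ x in 𝓝 x0, p x.1 ∈ ctlS XX := by
    have : Tendsto (fun x : V × (CMat n × ℝ) => x.1) (𝓝 x0) (𝓝 t0) := continuous_fst.tendsto x0
    exact this.eventually hS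
  have c2 : ∀ᶠ x in 𝓝 x0, (2 + mid x).det ≠ 0 := by
    have hc : Continuous fun x => (2 + mid x).det :=
      (continuous_const.add mid.continuous).matrix_det
    refine hc.continuousAt.eventually_ne ?_
    rw [mid0, add_zero]
    have : (2 : CMat n) = (2 : ℂ) • 1 := by
      ext i j; by_cases h : i = j <;> simp [h, Matrix.ofNat_apply]
    rw [this, Matrix.det_smul]; simp
  have c3 : ∀ᶠ x in 𝓝 x0, |n * ell x| < 2 * Real.pi := by
    have hc : Continuous fun x => |n * ell x| := (continuous_const.mul ell.continuous).abs
    refine hc.continuousAt.eventually_lt continuousAt_const ?_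
    rw [ell0]; simpa using Real.pi_pos
  filter_upwards [c1, c2, c3] with x hx1 hx2 hx3 hg
  change p x.1 * (1 + mid x) * exp (ell x • J) ∈ _ at hg
  change p x.1 * (1 + mid x) * exp (ell x • J) ∈ _
  have hp := ctlS_special hX htr hx1
  obtain ⟨hgu, hgd⟩ := Matrix.mem_specialUnitaryGroup_iff.1 hg
  obtain ⟨hpu, hpd⟩ := Matrix.mem_specialUnitaryGroup_iff.1 hp
  have hEu : exp (ell x • J) ∈ Matrix.unitaryGroup (Fin n) ℂ := mat_exp_unitary (skew_smul hJ _)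
  have hmids : star (mid x) = mid x := by
    change star (x.2.1 + star x.2.1) = x.2.1 + star x.2.1
    rw [star_add, star_star, add_comm]
  have hMu : 1 + mid x ∈ Matrix.unitaryGroup (Fin n) ℂ := by
    have h := mul_mem (mul_mem (Unitary.star_mem hpu) hgu) (Unitary.star_mem hEu)
    have e : star (p x.1) * (p x.1 * (1 + mid x) * exp (ell x • J)) * star (exp (ell x • J))
        = 1 + mid x := by
      calc _ = (star (p x.1) * p x.1) * (1 + mid x) * (exp (ell x • J) * star (exp (ell x • J))) := by
            noncomm_ring
        _ = _ := by
          rw [Matrix.mem_unitaryGroup_iff'.1 hpu, Matrix.mem_unitaryGroup_iff.1 hEu]; simp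
    rwa [e] at h
  have hmid : mid x = 0 := by
    have h := Matrix.mem_unitaryGroup_iff.1 hMu
    rw [star_add, star_one, hmids] at h
    have h' : (2 + mid x) * mid x = 0 := by
      have : (1 + mid x) * (1 + mid x) = 1 + (2 + mid x) * mid x := by noncomm_ring
      rw [this] at h
      simpa using h
    have hu : IsUnit (2 + mid x).det := isUnit_iff_ne_zero.2 hx2
    have := congrArg (fun A => (2 + mid x)⁻¹ * A) h'
    simpa [← mul_assoc, Matrix.nonsing_inv_mul _ hu] using this
  have hell : ell x = 0 := by
    rw [hmid, add_zero, mul_one, Matrix.det_mul, hpd, one_mul, skew_det_exp (skew_smul hJ _)] at hgd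
    have : (ell x • J).trace = ((n * ell x : ℝ) : ℂ) * Complex.I := by
      simp only [J, Matrix.trace_smul, Matrix.trace_one, Fintype.card_fin, Complex.real_smul, smul_eq_mul]
      push_cast; ring
    rw [this] at hgd
    obtain ⟨k, hk⟩ := Complex.exp_eq_one_iff.1 hgd
    have hk' : (n * ell x : ℝ) = k * (2 * Real.pi) := by
      have : (((n * ell x : ℝ) : ℂ)) * Complex.I = ((k * (2 * Real.pi) : ℝ) : ℂ) * Complex.I := by
        rw [hk]; push_cast; ring
      exact_mod_cast mul_right_cancel₀ Complex.I_ne_zero this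
    rw [hk', abs_mul, abs_of_pos Real.two_pi_pos] at hx3
    have hk1 : |(k : ℝ)| < 1 := by
      by_contra hcon
      push Not at hcon
      nlinarith [Real.two_pi_pos]
    have hk0 : k = 0 := by
      have : |k| < 1 := by exact_mod_cast hk1
      exact Int.abs_lt_one_iff.1 this
    rw [hk0] at hk'
    have hn' : (n : ℝ) ≠ 0 := by exact_mod_cast hn.ne'
    simpa [hn.ne'] using hk'
  rw [hmid, hell]
  simpa using hx1

theorem special_sub (hn : 0 < n) (hX : ∀ X ∈ XX, star X = -X) (htr : ∀ X ∈ XX, X.trace = 0)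
    (hfull : ∀ Y : CMat n, star Y = -Y → Y.trace = 0 → Y ∈ ctlL XX) {g : CMat n}
    (hg : g ∈ Matrix.specialUnitaryGroup (Fin n) ℂ) : g ∈ ctlS XX := by
  obtain ⟨q, hq, hev⟩ := local_open hn hX htr hfull
  have hqu := ctlS_unitary hX hq
  have hone : ∀ᶠ h in 𝓝 (1 : CMat n), h ∈ Matrix.specialUnitaryGroup (Fin n) ℂ → h ∈ ctlS XX := by
    have ht : Tendsto (fun x : CMat n × CMat n => star x.1 * x.2) (𝓝 (star q, 1)) (𝓝 q) := by
      have hc : Continuous (fun x : CMat n × CMat n => star x.1 * x.2) := by fun_prop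
      have := hc.tendsto (star q, 1)
      simpa using this
    have h1 := (ht.eventually hev).curry_nhds
    have h2 : ∃ᶠ s in 𝓝 (star q), s ∈ ctlS XX :=
      mem_closure_iff_frequently.1 (ctlG_star hX (ctlS_sub hq))
    obtain ⟨s, hs, hs2⟩ := (h2.and_eventually h1).exists
    filter_upwards [hs2] with h hh hSU
    have hsSU := ctlS_special hX htr hs
    obtain ⟨hsu, hsd⟩ := Matrix.mem_specialUnitaryGroup_iff.1 hsSU
    have h3 : star s * h ∈ Matrix.specialUnitaryGroup (Fin n) ℂ := by
      refine mul_mem (Matrix.mem_specialUnitaryGroup_iff.2 ⟨Unitary.star_mem hsu, ?_⟩) hSU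
      rw [Matrix.star_eq_conjTranspose, Matrix.det_conjTranspose, hsd, star_one]
    have h4 := mul_mem hs (hh h3)
    rwa [← mul_assoc, Matrix.mem_unitaryGroup_iff.1 hsu, one_mul] at h4
  obtain ⟨Y, hY, hYtr, rfl⟩ := exp_surj hn hg
  have hlim : Tendsto (fun k : ℕ => exp ((1 / ((k : ℝ) + 1)) • Y)) atTop (𝓝 1) := by
    have h1 : Tendsto (fun t : ℝ => exp (t • Y)) (𝓝 0) (𝓝 1) := by
      have := (mat_exp_deriv Y 0).hasDerivAt.continuousAt.tendsto
      rw [zero_smul, exp_zero] at this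
      exact this
    exact h1.comp tendsto_one_div_add_atTop_nhds_zero_nat
  obtain ⟨k, hk⟩ := (hlim.eventually hone).exists
  have hsk := skew_smul hY (1 / ((k : ℝ) + 1))
  have h5 : exp ((1 / ((k : ℝ) + 1)) • Y) ∈ ctlS XX := by
    apply hk
    refine Matrix.mem_specialUnitaryGroup_iff.2 ⟨mat_exp_unitary hsk, ?_⟩
    rw [skew_det_exp hsk, Matrix.trace_smul, hYtr, smul_zero, Complex.exp_zero]
  have h6 := pow_mem h5 (k + 1)
  rw [← Matrix.exp_nsmul] at h6
  have e : (k + 1) • ((1 / ((k : ℝ) + 1)) • Y) = Y := by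
    rw [← Nat.cast_smul_eq_nsmul ℝ, smul_smul]
    have : ((k : ℝ) + 1) ≠ 0 := by positivity
    push_cast
    rw [mul_one_div_cancel this, one_smul]
  rwa [e] at h6

end Krener

end

section

attribute [local instance] Matrix.normedAddCommGroup Matrix.normedSpace

open NormedSpace Filter Topology

section LieAlg

variable {n : ℕ}

/-- The skew-hermitian elementary matrices. -/
def Ez (a b : Fin n) (z : ℂ) : CMat n := Matrix.single a b z - Matrix.single b a (star z)

theorem Ez_swap (a b : Fin n) (z : ℂ) : Ez b a z = -Ez a b (star z) := by
  simp [Ez]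

theorem Ez_add (a b : Fin n) (z w : ℂ) : Ez a b (z + w) = Ez a b z + Ez a b w := by
  simp only [Ez, star_add, Matrix.single_add]; abel

theorem Ez_smul (a b : Fin n) (c : ℝ) (z : ℂ) : Ez a b (c * z) = c • Ez a b z := by
  simp only [Ez, smul_sub, Matrix.smul_single]; simp

theorem Ez_bracket {a b c : Fin n} (hab : a ≠ b) (hbc : b ≠ c) (hac : a ≠ c) (z w : ℂ) :
    Ez a b z * Ez b c w - Ez b c w * Ez a b z = Ez a c (z * w) := by
  have k : ∀ (i j k l : Fin n), j ≠ k → ∀ x y : ℂ,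
      Matrix.single i j x * Matrix.single k l y = 0 :=
    fun i j k l h x y => by rw [Matrix.single_mul_single_of_ne]; exact h
  simp only [Ez, sub_mul, mul_sub, Matrix.single_mul_single_same, k _ _ _ _ hab, k _ _ _ _ hab.symm,
    k _ _ _ _ hbc, k _ _ _ _ hbc.symm, k _ _ _ _ hac, k _ _ _ _ hac.symm, star_mul]
  simp

theorem Ez_bracket' {a b : Fin n} (hab : a ≠ b) {z : ℂ} (hz : star z = -z) :
    Ez a b 1 * Ez a b z - Ez a b z * Ez a b 1 = Ez a a z - Ez b b z := by
  have k : ∀ (i j k l : Fin n), j ≠ k → ∀ x y : ℂ,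
      Matrix.single i j x * Matrix.single k l y = 0 :=
    fun i j k l h x y => by rw [Matrix.single_mul_single_of_ne]; exact h
  have hneg : ∀ (i j : Fin n) (x : ℂ), Matrix.single i j (-x) = - Matrix.single i j x :=
    fun i j x => (Matrix.single_neg i j x).symm
  simp only [Ez, sub_mul, mul_sub, Matrix.single_mul_single_same, k _ _ _ _ hab, k _ _ _ _ hab.symm,
    hz, star_one, one_mul, mul_one, hneg, mul_neg, neg_mul]
  abel

theorem lie_gen (hn : 0 < n) (L : Submodule ℝ (CMat n))
    (hbr : ∀ A ∈ L, ∀ B ∈ L, A * B - B * A ∈ L)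
    (hadj : ∀ j k : Fin n, (j : ℕ) + 1 = k → ∀ z, Ez j k z ∈ L)
    {Y : CMat n} (hY : star Y = -Y) (htr : Y.trace = 0) : Y ∈ L := by
  have g0 : ∀ d : ℕ, ∀ a b : Fin n, (a : ℕ) + d + 1 = b → ∀ z, Ez a b z ∈ L := by
    intro d
    induction d with
    | zero => intro a b h z; exact hadj a b (by omega) z
    | succ d ih =>
      intro a b h z
      have hb := b.2
      let c : Fin n := ⟨a + d + 1, by omega⟩
      have h1 := ih a c rfl z
      have h2 := hadj c b (by simp only [c]; omega) 1
      have h3 := hbr _ h1 _ h2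
      rw [Ez_bracket (Fin.ne_of_val_ne (by simp only [c]; omega)) (Fin.ne_of_val_ne (by simp only [c]; omega))
        (Fin.ne_of_val_ne (by omega)), mul_one] at h3
      exact h3
  have g1 : ∀ a b : Fin n, a ≠ b → ∀ z, Ez a b z ∈ L := by
    intro a b hab z
    rcases lt_or_gt_of_ne hab with h | h
    · have : (a : ℕ) < b := h
      exact g0 (b - a - 1) a b (by omega) z
    · have : (b : ℕ) < a := h
      rw [Ez_swap]
      exact neg_mem (g0 (a - b - 1) b a (by omega) _)
  have g2 : ∀ a b : Fin n, ∀ z : ℂ, star z = -z → Ez a a z - Ez b b z ∈ L := by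
    intro a b z hz
    by_cases hab : a = b
    · subst hab; simp
    · rw [← Ez_bracket' hab hz]
      exact hbr _ (g1 a b hab 1) _ (g1 a b hab z)
  let o : Fin n := ⟨0, hn⟩
  have hYd : ∀ a, star (Y a a) = - Y a a := by
    intro a
    have := congrFun (congrFun hY a) a
    simpa [Matrix.star_apply] using this
  have hsum : ∑ a, Ez o o (Y a a) = 0 := by
    have : ∀ s : Finset (Fin n), ∑ a ∈ s, Ez o o (Y a a) = Ez o o (∑ a ∈ s, Y a a) := by
      intro s
      induction s using Finset.induction_on with
      | empty => simp [Ez]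
      | insert a s ha ih => rw [Finset.sum_insert ha, Finset.sum_insert ha, Ez_add, ih]
    rw [this]
    have h0 : ∑ a, Y a a = 0 := htr
    rw [h0]; simp [Ez]
  have key : (2 : ℝ) • Y = ∑ a, ∑ b, (if a = b then Ez a a (Y a a) - Ez o o (Y a a) else Ez a b (Y a b)) := by
    have e1 : (2 : ℝ) • Y = Y - star Y := by rw [hY, two_smul]; abel
    have e2 : Y - star Y = ∑ a, ∑ b, Ez a b (Y a b) := by
      have h1 := Matrix.matrix_eq_sum_single Y
      have h2 : star Y = ∑ a, ∑ b, Matrix.single b a (star (Y a b)) := by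
        conv_lhs => rw [h1]
        simp [star_sum, Matrix.star_eq_conjTranspose, Matrix.conjTranspose_single]
      conv_lhs => rw [h2, h1]
      simp only [← Finset.sum_sub_distrib, Ez]
      refine Finset.sum_congr rfl fun a _ => Finset.sum_congr rfl fun b _ => ?_
      rw [← h1]
    have e3 : ∑ a, ∑ b, (if a = b then Ez a a (Y a a) - Ez o o (Y a a) else Ez a b (Y a b))
        = ∑ a, (∑ b, Ez a b (Y a b) - Ez o o (Y a a)) := by
      refine Finset.sum_congr rfl fun a _ => ?_
      have : ∀ b, (if a = b then Ez a a (Y a a) - Ez o o (Y a a) else Ez a b (Y a b))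
        = Ez a b (Y a b) - if a = b then Ez o o (Y a a) else 0 := by
        intro b
        split_ifs with h
        · subst h; rfl
        · simp
      simp only [this, Finset.sum_sub_distrib, Finset.sum_ite_eq, Finset.mem_univ, if_true]
    rw [e1, e2, e3, Finset.sum_sub_distrib, hsum, sub_zero]
  have h2 : (2 : ℝ) • Y ∈ L := by
    rw [key]
    refine sum_mem fun a _ => sum_mem fun b _ => ?_
    split_ifs with h
    · exact g2 a o _ (hYd a)
    · exact g1 a b h _
  have := L.smul_mem (1/2 : ℝ) h2
  rwa [smul_smul, one_div, inv_mul_cancel₀ (by norm_num), one_smul] at this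

theorem lie_ext (L : Submodule ℝ (CMat n))
    (hbr : ∀ A ∈ L, ∀ B ∈ L, A * B - B * A ∈ L) (d : Fin n → ℝ)
    (hd : Matrix.diagonal (fun i => -Complex.I * (d i : ℂ)) ∈ L) {B : CMat n} (hB : B ∈ L)
    (hBs : star B = -B) {j k : Fin n} (hjk : d j ≠ d k)
    (hgap : ∀ a b, ¬ (a = j ∧ b = k) → ¬ (a = k ∧ b = j) → (d a - d b) ^ 2 ≠ (d j - d k) ^ 2)
    (hBjk : B j k ≠ 0) (z : ℂ) : Ez j k z ∈ L := by
  have hne : j ≠ k := fun h => hjk (by rw [h])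
  let Bs : Finset (Fin n × Fin n) → CMat n := fun s => Matrix.of fun a b =>
    ((∏ p ∈ s, ((d p.1 - d p.2) ^ 2 - (d a - d b) ^ 2) : ℝ) : ℂ) * B a b
  have hBsL : ∀ s, Bs s ∈ L := by
    intro s
    induction s using Finset.induction_on with
    | empty =>
      have : Bs ∅ = B := by ext a b; simp [Bs]
      rw [this]; exact hB
    | insert p s hp ih =>
      set Dg : CMat n := Matrix.diagonal (fun i => -Complex.I * (d i : ℂ)) with hDg
      have h1 := hbr _ hd _ (hbr _ hd _ ih)
      have h2 := add_mem h1 (L.smul_mem ((d p.1 - d p.2) ^ 2) ih)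
      have e : Bs (insert p s) = Dg * (Dg * Bs s - Bs s * Dg) - (Dg * Bs s - Bs s * Dg) * Dg
          + ((d p.1 - d p.2) ^ 2) • Bs s := by
        ext a b
        simp only [hDg, Matrix.add_apply, Matrix.sub_apply, Matrix.smul_apply,
          Matrix.diagonal_mul, Matrix.mul_diagonal, Bs, Matrix.of_apply, Finset.prod_insert hp,
          Complex.real_smul]
        push_cast
        have hI : Complex.I ^ 2 = -1 := Complex.I_sq
        linear_combination (-(d a - d b : ℂ) ^ 2 * ((∏ p ∈ s, (((d p.1 : ℂ) - d p.2) ^ 2 - ((d a : ℂ) - d b) ^ 2)) * B a b)) * hI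
      rw [e]; exact h2
  let s0 : Finset (Fin n × Fin n) := Finset.univ.filter fun p => p ≠ (j, k) ∧ p ≠ (k, j)
  let c : ℝ := ∏ p ∈ s0, ((d p.1 - d p.2) ^ 2 - (d j - d k) ^ 2)
  have hc : c ≠ 0 := by
    refine Finset.prod_ne_zero_iff.2 fun p hp => ?_
    simp only [s0, Finset.mem_filter, Finset.mem_univ, true_and, ne_eq, Prod.ext_iff] at hp
    exact sub_ne_zero.2 (hgap p.1 p.2 hp.1 hp.2)
  have hBkj : B k j = - star (B j k) := by
    have := congrFun (congrFun hBs k) j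
    simp only [Matrix.star_apply, Matrix.neg_apply] at this
    rw [this, neg_neg]
  have hform : Bs s0 = Ez j k (c * B j k) := by
    ext a b
    simp only [Bs, Matrix.of_apply, Ez, Matrix.sub_apply]
    by_cases h1 : a = j ∧ b = k
    · obtain ⟨rfl, rfl⟩ := h1
      simp [Matrix.single_apply, hne, hne.symm, c]
    · by_cases h2 : a = k ∧ b = j
      · obtain ⟨rfl, rfl⟩ := h2
        have : (d a - d b) ^ 2 = (d b - d a) ^ 2 := by ring
        simp [Matrix.single_apply, hne, hne.symm, c, hBkj, this]
      · have hz : (∏ p ∈ s0, ((d p.1 - d p.2) ^ 2 - (d a - d b) ^ 2) : ℝ) = 0 := by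
          refine Finset.prod_eq_zero (i := (a, b)) ?_ (sub_self _)
          simp only [s0, Finset.mem_filter, Finset.mem_univ, true_and, ne_eq, Prod.ext_iff]
          exact ⟨h1, h2⟩
        have h1' : ¬ (j = a ∧ k = b) := fun h => h1 ⟨h.1.symm, h.2.symm⟩
        have h2' : ¬ (k = a ∧ j = b) := fun h => h2 ⟨h.1.symm, h.2.symm⟩
        rw [hz]
        simp [Matrix.single_apply, h1', h2']
  have m1 : Ez j k (c * B j k) ∈ L := hform ▸ hBsL s0
  have m2 : Ez j k (Complex.I * (c * B j k)) ∈ L := by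
    have h := L.smul_mem (-(d j - d k)⁻¹) (hbr _ hd _ m1)
    have e : (-(d j - d k)⁻¹) • (Matrix.diagonal (fun i => -Complex.I * (d i : ℂ)) * Ez j k (c * B j k)
        - Ez j k (c * B j k) * Matrix.diagonal (fun i => -Complex.I * (d i : ℂ)))
        = Ez j k (Complex.I * (c * B j k)) := by
      have hdd : (d j : ℂ) - d k ≠ 0 := by
        exact_mod_cast sub_ne_zero.2 hjk
      ext a b
      simp only [Matrix.sub_apply, Matrix.smul_apply, Matrix.diagonal_mul, Matrix.mul_diagonal,
        Ez, Complex.real_smul]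
      by_cases h1 : a = j ∧ b = k
      · obtain ⟨rfl, rfl⟩ := h1
        simp [Matrix.single_apply, hne, hne.symm]
        field_simp
        ring
      · by_cases h2 : a = k ∧ b = j
        · obtain ⟨rfl, rfl⟩ := h2
          simp [Matrix.single_apply, hne, hne.symm]
          field_simp
          ring
        · have h1' : ¬ (j = a ∧ k = b) := fun h => h1 ⟨h.1.symm, h.2.symm⟩
          have h2' : ¬ (k = a ∧ j = b) := fun h => h2 ⟨h.1.symm, h.2.symm⟩
          simp [Matrix.single_apply, h1', h2']
    rwa [e] at h
  obtain ⟨w, hw⟩ : ∃ w : ℂ, w = c * B j k := ⟨_, rfl⟩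
  rw [← hw] at m1 m2
  have hw0 : w ≠ 0 := hw ▸ mul_ne_zero (by exact_mod_cast hc) hBjk
  have hz : z = ((z / w).re : ℝ) * w + ((z / w).im : ℝ) * (Complex.I * w) := by
    have h1 : z = (z / w) * w := by field_simp
    have h2 := Complex.re_add_im (z / w)
    calc z = (z / w) * w := h1
      _ = (((z / w).re : ℂ) + ((z / w).im : ℂ) * Complex.I) * w := by rw [h2]
      _ = _ := by ring
  rw [hz, Ez_add, Ez_smul, Ez_smul]
  exact add_mem (L.smul_mem _ m1) (L.smul_mem _ m2)

end LieAlg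

end

section

attribute [local instance] Matrix.normedAddCommGroup Matrix.normedSpace

open NormedSpace Filter Topology

section Connect

theorem ball_diff_preconnected {m : ℕ} (hm : 2 ≤ m) (c : EuclideanSpace ℝ (Fin m)) {r : ℝ}
    (hr : 0 < r) {Z : Set (EuclideanSpace ℝ (Fin m))} (hZ : Z.Countable) :
    IsPreconnected (Metric.ball c r \ Z) := by
  let f := OpenPartialHomeomorph.univBall c r
  have hfs : f.source = Set.univ := OpenPartialHomeomorph.univBall_source c r
  have hft : f.target = Metric.ball c r := OpenPartialHomeomorph.univBall_target c hr
  have hinj : Function.Injective f := by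
    intro x y hxy
    exact f.injOn (by rw [hfs]; trivial) (by rw [hfs]; trivial) hxy
  have hcont : Continuous f := by
    have := f.continuousOn
    rwa [hfs, ← continuousOn_univ] at *
  have hZ' : (f ⁻¹' Z).Countable := hZ.preimage_of_injOn hinj.injOn
  have hrank : 1 < Module.rank ℝ (EuclideanSpace ℝ (Fin m)) := by
    rw [← Module.finrank_eq_rank, finrank_euclideanSpace_fin]
    exact_mod_cast hm
  have h1 := (hZ'.isConnected_compl_of_one_lt_rank hrank).isPreconnected
  have h2 := h1.image f hcont.continuousOn
  have e : f '' (f ⁻¹' Z)ᶜ = Metric.ball c r \ Z := by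
    ext y
    constructor
    · rintro ⟨x, hx, rfl⟩
      refine ⟨?_, hx⟩
      rw [← hft]
      exact f.map_source (by rw [hfs]; trivial)
    · rintro ⟨hy, hyZ⟩
      rw [← hft] at hy
      refine ⟨f.symm y, ?_, f.right_inv hy⟩
      simpa [f.right_inv hy] using hyZ
  rwa [e] at h2

theorem preconnected_prop {E : Type*} [TopologicalSpace E] {S : Set E} (hS : IsPreconnected S)
    {A : Set E} (ho : ∀ u ∈ S, u ∈ A → ∀ᶠ v in 𝓝 u, v ∈ S → v ∈ A)
    (hc : ∀ u ∈ S, (∃ᶠ v in 𝓝 u, v ∈ S ∧ v ∈ A) → u ∈ A)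
    (hne : ∃ u ∈ S, u ∈ A) : ∀ u ∈ S, u ∈ A := by
  haveI : PreconnectedSpace S := isPreconnected_iff_preconnectedSpace.1 hS
  let A' : Set S := {x | (x : E) ∈ A}
  have hclopen : IsClopen A' := by
    constructor
    · rw [← isOpen_compl_iff, isOpen_iff_mem_nhds]
      intro x hx
      have h1 : ¬ ∃ᶠ v in 𝓝 (x : E), v ∈ S ∧ v ∈ A := fun h => hx (hc x x.2 h)
      rw [not_frequently] at h1
      have h2 := continuous_subtype_val.continuousAt.eventually h1
      filter_upwards [h2] with y hy hyA
      exact hy ⟨y.2, hyA⟩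
    · rw [isOpen_iff_mem_nhds]
      intro x hx
      have h2 := continuous_subtype_val.continuousAt.eventually (ho x x.2 hx)
      filter_upwards [h2] with y hy
      exact hy y.2
  obtain ⟨u0, hu0, hA0⟩ := hne
  have := hclopen.eq_univ ⟨⟨u0, hu0⟩, hA0⟩
  intro u hu
  have h : (⟨u, hu⟩ : S) ∈ A' := by rw [this]; trivial
  exact h

theorem connect_lemma {m : ℕ} (hm : 2 ≤ m) {U : Set (EuclideanSpace ℝ (Fin m))}
    (hUo : IsOpen U) (hUc : IsPreconnected U) {Z : Set (EuclideanSpace ℝ (Fin m))}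
    (hZ : Z.Countable) {A : Set (EuclideanSpace ℝ (Fin m))}
    (ho : ∀ u ∈ U \ Z, u ∈ A → ∀ᶠ v in 𝓝 u, v ∈ U \ Z → v ∈ A)
    (hc : ∀ u ∈ U \ Z, (∃ᶠ v in 𝓝 u, v ∈ U \ Z ∧ v ∈ A) → u ∈ A)
    (hne : ∃ u ∈ U \ Z, u ∈ A) : ∀ u ∈ U \ Z, u ∈ A := by
  have hball : ∀ (c : EuclideanSpace ℝ (Fin m)) (r : ℝ), 0 < r → Metric.ball c r ⊆ U →
      (∃ u ∈ Metric.ball c r \ Z, u ∈ A) → ∀ u ∈ Metric.ball c r \ Z, u ∈ A := by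
    intro c r hr hsub hne
    have hsub' : Metric.ball c r \ Z ⊆ U \ Z := fun x hx => ⟨hsub hx.1, hx.2⟩
    refine preconnected_prop (ball_diff_preconnected hm c hr hZ) ?_ ?_ hne
    · intro u hu huA
      filter_upwards [ho u (hsub' hu) huA] with v hv hvB
      exact hv (hsub' hvB)
    · intro u hu h
      exact hc u (hsub' hu) (h.mono fun v hv => ⟨hsub' hv.1, hv.2⟩)
  haveI : Nonempty (Fin m) := ⟨⟨0, by omega⟩⟩
  have hdense : Dense Zᶜ := hZ.dense_compl ℝ
  let P : Set (EuclideanSpace ℝ (Fin m)) :=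
    {u | ∃ r > 0, Metric.ball u r ⊆ U ∧ ∀ v ∈ Metric.ball u r \ Z, v ∈ A}
  have hP : ∀ u ∈ U, u ∈ P := by
    refine preconnected_prop hUc ?_ ?_ ?_
    · rintro u hu ⟨r, hr, hrU, hrA⟩
      filter_upwards [Metric.ball_mem_nhds u hr] with v hv _
      have hd : 0 < r - dist v u := sub_pos.2 hv
      have hs : Metric.ball v (r - dist v u) ⊆ Metric.ball u r :=
        Metric.ball_subset_ball' (by linarith)
      exact ⟨_, hd, hs.trans hrU, fun w hw => hrA w ⟨hs hw.1, hw.2⟩⟩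
    · intro u hu h
      obtain ⟨r, hr, hrU⟩ := Metric.isOpen_iff.1 hUo u hu
      obtain ⟨v, ⟨_, s, hs, hsU, hsA⟩, hvr⟩ := (h.and_eventually (Metric.ball_mem_nhds u hr)).exists
      refine ⟨r, hr, hrU, hball u r hr hrU ?_⟩
      obtain ⟨w, hw, hwZ⟩ := hdense.inter_open_nonempty (Metric.ball u r ∩ Metric.ball v s)
        (Metric.isOpen_ball.inter Metric.isOpen_ball) ⟨v, hvr, Metric.mem_ball_self hs⟩
      exact ⟨w, ⟨hw.1, hwZ⟩, hsA w ⟨hw.2, hwZ⟩⟩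
    · obtain ⟨u, hu, huA⟩ := hne
      obtain ⟨r, hr, hrU⟩ := Metric.isOpen_iff.1 hUo u hu.1
      exact ⟨u, hu.1, r, hr, hrU, hball u r hr hrU ⟨u, ⟨Metric.mem_ball_self hr, hu.2⟩, huA⟩⟩
  intro u hu
  obtain ⟨r, hr, hrU, hrA⟩ := hP u hu.1
  exact hrA u ⟨Metric.mem_ball_self hr, hu.2⟩

end Connect

end

section

attribute [local instance] Matrix.normedAddCommGroup Matrix.normedSpace

open NormedSpace Filter Topology

section Spectral

/-- `Q` is a unitary matrix diagonalizing `H`, with ordered diagonal `l`. -/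
def DgAt {n : ℕ} (H : CMat n) (l : Fin n → ℝ) (Q : CMat n) : Prop :=
  Q ∈ Matrix.unitaryGroup (Fin n) ℂ ∧
    H = Q * Matrix.diagonal (fun i => (l i : ℂ)) * star Q

theorem monotone_unique_of_prod {n : ℕ} {a b : Fin n → ℝ} (ha : Monotone a) (hb : Monotone b)
    (h : ∏ j, (Polynomial.X - Polynomial.C ((a j : ℂ))) =
      ∏ j, (Polynomial.X - Polynomial.C ((b j : ℂ)))) : a = b := by
  have key : ∀ a : Fin n → ℝ, (∏ j, (Polynomial.X - Polynomial.C ((a j : ℂ)))).roots =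
      ((List.ofFn a : Multiset ℝ)).map (fun x : ℝ => (x : ℂ)) := by
    intro a
    have : (∏ j, (Polynomial.X - Polynomial.C ((a j : ℂ)))) =
        (((List.ofFn a : Multiset ℝ).map (fun x : ℝ => (x : ℂ))).map
          (fun x => Polynomial.X - Polynomial.C x)).prod := by
      simp [List.prod_ofFn, Function.comp_def]
    rw [this, Polynomial.roots_multiset_prod_X_sub_C]
  have h2 := congrArg Polynomial.roots h
  rw [key, key] at h2
  have h3 := Multiset.map_injective Complex.ofReal_injective h2
  have h4 : (List.ofFn a).Perm (List.ofFn b) := Multiset.coe_eq_coe.1 h3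
  have h5 : List.ofFn a = List.ofFn b := by
    refine h4.eq_of_pairwise' (r := (· ≤ ·)) ?_ ?_
    · exact (List.pairwise_ofFn).2 fun i j hij => ha hij.le
    · exact (List.pairwise_ofFn).2 fun i j hij => hb hij.le
  exact List.ofFn_injective h5

theorem DgAt.charpoly {n : ℕ} {H Q : CMat n} {l : Fin n → ℝ} (h : DgAt H l Q) :
    H.charpoly = ∏ j, (Polynomial.X - Polynomial.C ((l j : ℂ))) := by
  rw [h.2, Matrix.charpoly_mul_comm, ← mul_assoc, Matrix.mem_unitaryGroup_iff'.1 h.1, one_mul,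
    Matrix.charpoly_diagonal]

theorem DgAt.exists_mono {n : ℕ} {H : CMat n} (hH : H.IsHermitian) :
    ∃ Q l, Monotone l ∧ DgAt H l Q := by
  obtain ⟨Q, hQ, b, hb⟩ := herm_diag hH
  refine ⟨Q.submatrix id (Tuple.sort b), b ∘ Tuple.sort b, Tuple.monotone_sort b, ?_, ?_⟩
  · rw [Matrix.mem_unitaryGroup_iff]
    have := Matrix.mem_unitaryGroup_iff.1 hQ
    rw [← this, Matrix.star_eq_conjTranspose, Matrix.star_eq_conjTranspose,
      Matrix.conjTranspose_submatrix, Matrix.submatrix_mul_equiv, Matrix.submatrix_id_id]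
  · rw [hb]
    have : Matrix.diagonal (fun i => (((b ∘ Tuple.sort b) i : ℝ) : ℂ)) =
      (Matrix.diagonal (fun i => (b i : ℂ))).submatrix (Tuple.sort b) (Tuple.sort b) := by
      rw [Matrix.submatrix_diagonal_equiv]; rfl
    rw [this, Matrix.star_eq_conjTranspose, Matrix.star_eq_conjTranspose,
      Matrix.conjTranspose_submatrix, Matrix.submatrix_mul_equiv, Matrix.submatrix_mul_equiv,
      Matrix.submatrix_id_id]

variable {n m : ℕ} {H0 : CMat n} {Hc : Fin m → CMat n}
  {U : Set (EuclideanSpace ℝ (Fin m))} {lam : EuclideanSpace ℝ (Fin m) → Fin n → ℝ}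

/-- The directional part of the Hamiltonian. -/
noncomputable def VV {n m : ℕ} (Hc : Fin m → CMat n) (v : EuclideanSpace ℝ (Fin m)) : CMat n :=
  ∑ i, (v i : ℂ) • Hc i

theorem VV_herm (hHc : ∀ i, (Hc i).IsHermitian) (v : EuclideanSpace ℝ (Fin m)) :
    (VV Hc v).IsHermitian := by
  unfold VV Matrix.IsHermitian
  rw [Matrix.conjTranspose_sum]
  refine Finset.sum_congr rfl fun i _ => ?_
  rw [Matrix.conjTranspose_smul, (hHc i).eq]
  simp

theorem controlHam_herm (hH0 : H0.IsHermitian) (hHc : ∀ i, (Hc i).IsHermitian)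
    (u : EuclideanSpace ℝ (Fin m)) : (controlHam H0 Hc u).IsHermitian :=
  hH0.add (VV_herm hHc u)

theorem VV_add (v w : EuclideanSpace ℝ (Fin m)) : VV Hc (v + w) = VV Hc v + VV Hc w := by
  simp [VV, add_smul, Finset.sum_add_distrib]

theorem VV_smul (t : ℝ) (v : EuclideanSpace ℝ (Fin m)) : VV Hc (t • v) = (t : ℂ) • VV Hc v := by
  simp [VV, Finset.smul_sum, mul_smul]

theorem controlHam_add (u : EuclideanSpace ℝ (Fin m)) (t : ℝ) (v : EuclideanSpace ℝ (Fin m)) :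
    controlHam H0 Hc (u + t • v) = controlHam H0 Hc u + (t : ℂ) • VV Hc v := by
  rw [← VV_smul]
  show H0 + VV Hc _ = H0 + VV Hc _ + _
  rw [VV_add, add_assoc]

theorem VV_cont : Continuous (VV Hc) := by
  unfold VV
  fun_prop

theorem controlHam_cont : Continuous (controlHam H0 Hc) :=
  continuous_const.add VV_cont

theorem dg_unique (hlam : IsOrderedSpectrum H0 Hc U lam) {u : EuclideanSpace ℝ (Fin m)}
    (hu : u ∈ U) {l : Fin n → ℝ} {Q : CMat n} (hl : Monotone l)
    (h : DgAt (controlHam H0 Hc u) l Q) : l = lam u :=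
  monotone_unique_of_prod hl (hlam u hu).1 (h.charpoly.symm.trans (hlam u hu).2)

theorem dg_exists (hH0 : H0.IsHermitian) (hHc : ∀ i, (Hc i).IsHermitian)
    (hlam : IsOrderedSpectrum H0 Hc U lam) {u : EuclideanSpace ℝ (Fin m)}
    (hu : u ∈ U) : ∃ Q, DgAt (controlHam H0 Hc u) (lam u) Q := by
  obtain ⟨Q, l, hl, h⟩ := DgAt.exists_mono (controlHam_herm hH0 hHc u)
  obtain rfl := dg_unique hlam hu hl h
  exact ⟨Q, h⟩

theorem DgAt.conj_eq {H Q : CMat n} {l : Fin n → ℝ} (h : DgAt H l Q) :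
    star Q * H * Q = Matrix.diagonal (fun i => (l i : ℂ)) := by
  have h1 := Matrix.mem_unitaryGroup_iff'.1 h.1
  rw [h.2]
  calc _ = (star Q * Q) * Matrix.diagonal (fun i => (l i : ℂ)) * (star Q * Q) := by
        simp only [mul_assoc]
    _ = _ := by rw [h1]; simp

/-- Limits of eigenbases. -/
theorem dg_limit (hlam : IsOrderedSpectrum H0 Hc U lam)
    {ub : EuclideanSpace ℝ (Fin m)} (hub : ub ∈ U) {u : ℕ → EuclideanSpace ℝ (Fin m)}
    (hu : ∀ k, u k ∈ U) (hlim : Tendsto u atTop (𝓝 ub)) {Q : ℕ → CMat n}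
    (hQ : ∀ k, DgAt (controlHam H0 Hc (u k)) (lam (u k)) (Q k)) :
    ∃ φ : ℕ → ℕ, StrictMono φ ∧ ∃ Q', Tendsto (fun k => Q (φ k)) atTop (𝓝 Q') ∧
      DgAt (controlHam H0 Hc ub) (lam ub) Q' ∧
      Tendsto (fun k => lam (u (φ k))) atTop (𝓝 (lam ub)) := by
  obtain ⟨Q', hQ', φ, hφ, hl⟩ := (isCompact_unitaryGroup n).tendsto_subseq
    (x := Q) (fun k => (hQ k).1)
  have hl' : Tendsto (fun k => Q (φ k)) atTop (𝓝 Q') := hl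
  have huφ : Tendsto (fun k => u (φ k)) atTop (𝓝 ub) := hlim.comp hφ.tendsto_atTop
  have hH : Tendsto (fun k => controlHam H0 Hc (u (φ k))) atTop (𝓝 (controlHam H0 Hc ub)) :=
    (controlHam_cont.tendsto ub).comp huφ
  have hstar : Tendsto (fun k => star (Q (φ k))) atTop (𝓝 (star Q')) :=
    ((continuous_star (R := CMat n)).tendsto Q').comp hl'
  have hD : Tendsto (fun k => star (Q (φ k)) * controlHam H0 Hc (u (φ k)) * Q (φ k)) atTop
      (𝓝 (star Q' * controlHam H0 Hc ub * Q')) := (hstar.mul hH).mul hl'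
  have hent : ∀ i j, Tendsto (fun k => (Matrix.diagonal (fun i => (lam (u (φ k)) i : ℂ)) : CMat n) i j)
      atTop (𝓝 ((star Q' * controlHam H0 Hc ub * Q') i j)) := by
    intro i j
    have h1 := ((continuous_apply_apply (ρ := fun _ _ => ℂ) i j).tendsto _).comp hD
    refine h1.congr fun k => ?_
    show (star (Q (φ k)) * controlHam H0 Hc (u (φ k)) * Q (φ k)) i j = _
    rw [(hQ (φ k)).conj_eq]
  let l : Fin n → ℝ := fun i => ((star Q' * controlHam H0 Hc ub * Q') i i).re
  have hll : Tendsto (fun k => lam (u (φ k))) atTop (𝓝 l) := by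
    rw [tendsto_pi_nhds]
    intro i
    have := (Complex.continuous_re.tendsto _).comp (hent i i)
    simpa [Function.comp_def] using this
  have hdiag : star Q' * controlHam H0 Hc ub * Q' = Matrix.diagonal (fun i => (l i : ℂ)) := by
    ext i j
    refine tendsto_nhds_unique (hent i j) ?_
    by_cases hij : i = j
    · subst hij
      simp only [Matrix.diagonal_apply_eq]
      exact (Complex.continuous_ofReal.tendsto _).comp ((tendsto_pi_nhds.1 hll) i)
    · simp only [Matrix.diagonal_apply_ne _ hij]
      exact tendsto_const_nhds
  have hdg : DgAt (controlHam H0 Hc ub) l Q' := by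
    refine ⟨hQ', ?_⟩
    rw [← hdiag]
    have h1 := Matrix.mem_unitaryGroup_iff.1 hQ'
    calc _ = (Q' * star Q') * controlHam H0 Hc ub * (Q' * star Q') := by rw [h1]; simp
      _ = _ := by simp only [mul_assoc]
  have hmono : Monotone l := by
    intro i j hij
    exact le_of_tendsto_of_tendsto' ((tendsto_pi_nhds.1 hll) i) ((tendsto_pi_nhds.1 hll) j)
      fun k => (hlam _ (hu _)).1 hij
  have hfin := dg_unique hlam hub hmono hdg
  rw [hfin] at hdg hll
  exact ⟨φ, hφ, Q', hl', hdg, hll⟩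

theorem lam_cont (hH0 : H0.IsHermitian) (hHc : ∀ i, (Hc i).IsHermitian)
    (hU : IsOpen U) (hlam : IsOrderedSpectrum H0 Hc U lam) {ub : EuclideanSpace ℝ (Fin m)}
    (hub : ub ∈ U) : ContinuousAt lam ub := by
  have key : Tendsto lam (𝓝[U] ub) (𝓝 (lam ub)) := by
    refine tendsto_of_subseq_tendsto fun us hus => ?_
    rw [tendsto_nhdsWithin_iff] at hus
    obtain ⟨N, hN⟩ := eventually_atTop.1 hus.2
    have hu : ∀ k, us (k + N) ∈ U := fun k => hN _ (by omega)
    choose Q hQ using fun k => dg_exists hH0 hHc hlam (hu k)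
    obtain ⟨φ, hφ, Q', -, -, h⟩ := dg_limit hlam hub hu
      (hus.1.comp (tendsto_add_atTop_nat N)) hQ
    exact ⟨fun k => φ k + N, h⟩
  rwa [hU.nhdsWithin_eq hub] at key

end Spectral

end

section

attribute [local instance] Matrix.normedAddCommGroup Matrix.normedSpace

open NormedSpace Filter Topology

section Perturb

variable {n m : ℕ} {H0 : CMat n} {Hc : Fin m → CMat n}
  {U : Set (EuclideanSpace ℝ (Fin m))} {lam : EuclideanSpace ℝ (Fin m) → Fin n → ℝ}

theorem tendsto_entry {A : ℕ → CMat n} {B : CMat n} (h : Tendsto A atTop (𝓝 B)) (i j : Fin n) :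
    Tendsto (fun k => A k i j) atTop (𝓝 (B i j)) :=
  ((continuous_apply_apply (ρ := fun _ _ => ℂ) i j).tendsto _).comp h

theorem pert {ub : EuclideanSpace ℝ (Fin m)}
    {t : ℕ → ℝ} (ht0 : ∀ k, t k ≠ 0)
    {v : ℕ → EuclideanSpace ℝ (Fin m)} {v' : EuclideanSpace ℝ (Fin m)}
    (hv : Tendsto v atTop (𝓝 v')) {Q : ℕ → CMat n} {Q' : CMat n}
    (hQ : ∀ k, DgAt (controlHam H0 Hc (ub + t k • v k)) (lam (ub + t k • v k)) (Q k))
    (hlim : Tendsto Q atTop (𝓝 Q')) (hQ' : DgAt (controlHam H0 Hc ub) (lam ub) Q') :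
    (∀ a b, a ≠ b → lam ub a = lam ub b → (star Q' * VV Hc v' * Q') a b = 0) ∧
    ∀ b, Tendsto (fun k => ((lam (ub + t k • v k) b : ℂ) - lam ub b) / t k) atTop
      (𝓝 ((star Q' * VV Hc v' * Q') b b)) := by
  have hN : Tendsto (fun k => star Q' * VV Hc (v k) * Q k) atTop
      (𝓝 (star Q' * VV Hc v' * Q')) :=
    (tendsto_const_nhds.mul ((VV_cont.tendsto v').comp hv)).mul hlim
  have hB : Tendsto (fun k => star Q' * Q k) atTop (𝓝 1) := by
    have := (tendsto_const_nhds (x := star Q') (f := atTop (α := ℕ))).mul hlim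
    rwa [Matrix.mem_unitaryGroup_iff'.1 hQ'.1] at this
  have hmat : ∀ k, Matrix.diagonal (fun i => (lam ub i : ℂ)) * (star Q' * Q k) +
      (t k : ℂ) • (star Q' * VV Hc (v k) * Q k) =
      (star Q' * Q k) * Matrix.diagonal (fun i => (lam (ub + t k • v k) i : ℂ)) := by
    intro k
    have h1 := (hQ k).conj_eq
    have h2 := hQ'.conj_eq
    have u1 := Matrix.mem_unitaryGroup_iff.1 (hQ k).1
    have u2 := Matrix.mem_unitaryGroup_iff.1 hQ'.1
    rw [← h1, ← h2]
    calc _ = star Q' * controlHam H0 Hc ub * (Q' * star Q') * Q k +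
          (t k : ℂ) • (star Q' * VV Hc (v k) * Q k) := by simp only [mul_assoc]
      _ = star Q' * (controlHam H0 Hc ub + (t k : ℂ) • VV Hc (v k)) * Q k := by
          rw [u2, mul_one, mul_add, add_mul]; simp
      _ = star Q' * ((Q k * star (Q k)) * controlHam H0 Hc (ub + t k • v k) * Q k) := by
          rw [u1, one_mul, controlHam_add, mul_assoc]
      _ = _ := by simp only [mul_assoc]
  have hent : ∀ k a b, (lam ub a : ℂ) * (star Q' * Q k) a b +
      (t k : ℂ) * (star Q' * VV Hc (v k) * Q k) a b =
      (star Q' * Q k) a b * (lam (ub + t k • v k) b : ℂ) := by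
    intro k a b
    have := congrFun (congrFun (hmat k) a) b
    rw [Matrix.add_apply, Matrix.diagonal_mul, Matrix.mul_diagonal, Matrix.smul_apply] at this
    exact this
  have hent' : ∀ k a b, lam ub a = lam ub b → (star Q' * VV Hc (v k) * Q k) a b =
      (star Q' * Q k) a b * (((lam (ub + t k • v k) b : ℂ) - lam ub b) / t k) := by
    intro k a b hab
    have h := hent k a b
    rw [hab] at h
    have : (t k : ℂ) ≠ 0 := by exact_mod_cast ht0 k
    field_simp
    linear_combination h
  have hq : ∀ b, Tendsto (fun k => ((lam (ub + t k • v k) b : ℂ) - lam ub b) / t k) atTop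
      (𝓝 ((star Q' * VV Hc v' * Q') b b)) := by
    intro b
    have h1 := tendsto_entry hB b b
    rw [Matrix.one_apply_eq] at h1
    have h2 := (tendsto_entry hN b b).div h1 one_ne_zero
    rw [div_one] at h2
    refine h2.congr' ?_
    filter_upwards [h1.eventually_ne one_ne_zero] with k hk
    simp only [Pi.div_apply]
    rw [hent' k b b rfl]
    field_simp
  refine ⟨fun a b hab hl => ?_, hq⟩
  have h1 := (tendsto_entry hB a b).mul (hq b)
  rw [Matrix.one_apply_ne hab, zero_mul] at h1
  exact tendsto_nhds_unique ((tendsto_entry hN a b).congr fun k => hent' k a b hl) h1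

/-- `V` acts as the scalar `ν` on the eigenspace for `μ`. -/
def Scal {n : ℕ} (l : Fin n → ℝ) (μ : ℝ) (V : CMat n) (ν : ℂ) (Q : CMat n) : Prop :=
  ∀ a b, l a = μ → l b = μ → (star Q * V * Q) a b = if a = b then ν else 0

theorem Scal.change {H V Q Q' : CMat n} {l : Fin n → ℝ} {μ : ℝ} {ν : ℂ}
    (hQ : DgAt H l Q) (hQ' : DgAt H l Q') (h : Scal l μ V ν Q) : Scal l μ V ν Q' := by
  have u := Matrix.mem_unitaryGroup_iff.1 hQ.1
  have u' := Matrix.mem_unitaryGroup_iff'.1 hQ'.1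
  set C := star Q * Q' with hC
  have hCu : star C * C = 1 := by
    rw [hC, star_mul, star_star]
    calc _ = star Q' * (Q * star Q) * Q' := by simp only [mul_assoc]
      _ = 1 := by rw [u, mul_one, u']
  have hcomm : Matrix.diagonal (fun i => (l i : ℂ)) * C = C * Matrix.diagonal (fun i => (l i : ℂ)) := by
    calc _ = star Q * H * (Q * star Q) * Q' := by rw [← hQ.conj_eq, hC]; simp only [mul_assoc]
      _ = star Q * ((Q' * star Q') * H * Q') := by
        rw [u, Matrix.mem_unitaryGroup_iff.1 hQ'.1]; simp only [mul_assoc, one_mul]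
      _ = _ := by rw [← hQ'.conj_eq, hC]; simp only [mul_assoc]
  have hz : ∀ a b, l a ≠ l b → C a b = 0 := by
    intro a b hab
    have := congrFun (congrFun hcomm a) b
    rw [Matrix.diagonal_mul, Matrix.mul_diagonal] at this
    have h2 : ((l a : ℂ) - l b) * C a b = 0 := by linear_combination this
    rcases mul_eq_zero.1 h2 with h3 | h3
    · exact absurd (by exact_mod_cast sub_eq_zero.1 h3) hab
    · exact h3
  have hM : star Q' * V * Q' = star C * ((star Q * V * Q) * C) := by
    calc _ = (star Q' * (Q * star Q)) * V * ((Q * star Q) * Q') := by rw [u]; simp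
      _ = _ := by rw [hC, star_mul, star_star]; simp only [mul_assoc]
  intro a b ha hb
  have h1 : ∀ c, l c = μ → ((star Q * V * Q) * C) c b = ν * C c b := by
    intro c hc
    rw [Matrix.mul_apply, Finset.sum_eq_single c]
    · rw [h c c hc hc, if_pos rfl]
    · intro d _ hd
      by_cases hl : l d = μ
      · rw [h c d hc hl, if_neg (Ne.symm hd), zero_mul]
      · rw [hz d b (by rw [hb]; exact hl), mul_zero]
    · simp
  have h2 : (star C * ((star Q * V * Q) * C)) a b = ν * (star C * C) a b := by
    rw [Matrix.mul_apply, Matrix.mul_apply, Finset.mul_sum]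
    refine Finset.sum_congr rfl fun c _ => ?_
    by_cases hl : l c = μ
    · rw [h1 c hl]; ring
    · rw [Matrix.star_apply, hz c a (by rw [ha]; exact hl)]; simp
  rw [hM, h2, hCu, Matrix.one_apply]
  simp

theorem conical_not_scal (hH0 : H0.IsHermitian) (hHc : ∀ i, (Hc i).IsHermitian)
    (hU : IsOpen U) (hlam : IsOrderedSpectrum H0 Hc U lam) {ub : EuclideanSpace ℝ (Fin m)}
    {j k : Fin n} (hcon : ConicalAt U lam j k ub)
    {Q : CMat n} (hQ : DgAt (controlHam H0 Hc ub) (lam ub) Q)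
    {v : EuclideanSpace ℝ (Fin m)} (hv : v ≠ 0) (ν : ℂ)
    (hs : Scal (lam ub) (lam ub j) (VV Hc v) ν Q) : False := by
  obtain ⟨hub, hjk, -, c, hc, hgap⟩ := hcon
  set w := ‖v‖⁻¹ • v with hw
  have hw1 : ‖w‖ = 1 := by
    rw [hw, norm_smul, norm_inv, norm_norm, inv_mul_cancel₀ (norm_ne_zero_iff.2 hv)]
  have hsw : Scal (lam ub) (lam ub j) (VV Hc w) ((‖v‖⁻¹ : ℝ) * ν) Q := by
    intro a b ha hb
    rw [hw, VV_smul, Matrix.mul_smul, Matrix.smul_mul, Matrix.smul_apply, hs a b ha hb]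
    split_ifs <;> simp
  obtain ⟨ε, hε, hgε⟩ := hgap w hw1
  have hev : ∀ᶠ t : ℝ in 𝓝 0, ub + t • w ∈ U := by
    have hc : ContinuousAt (fun t : ℝ => ub + t • w) 0 := by fun_prop
    refine hc.eventually_mem (hU.mem_nhds ?_)
    simpa using hub
  obtain ⟨δ, hδ, hδU⟩ := Metric.eventually_nhds_iff.1 hev
  let t : ℕ → ℝ := fun i => (min ε δ / 2) / (i + 1)
  have hmin : 0 < min ε δ := lt_min hε hδ
  have ht0 : ∀ i, 0 < t i := fun i => by positivity
  have htle : ∀ i, t i < min ε δ := fun i => by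
    have : t i ≤ min ε δ / 2 := div_le_self (by positivity) (by simp)
    linarith
  have htU : ∀ i, ub + t i • w ∈ U := fun i => hδU (by
    rw [Real.dist_0_eq_abs, abs_of_pos (ht0 i)]
    exact (htle i).trans_le (min_le_right _ _))
  have htl : Tendsto t atTop (𝓝 0) := by
    have := tendsto_const_div_atTop_nhds_zero_nat (min ε δ / 2)
    have h2 := (tendsto_add_atTop_iff_nat 1).2 this
    simpa [t] using h2
  choose Qs hQs using fun i => dg_exists hH0 hHc hlam (htU i)
  have hul : Tendsto (fun i => ub + t i • w) atTop (𝓝 ub) := by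
    have := (tendsto_const_nhds (x := ub)).add (htl.smul_const w)
    simpa using this
  obtain ⟨φ, hφ, Q', hQl, hQ', -⟩ := dg_limit hlam hub htU hul hQs
  have hp := (pert (lam := lam) (ub := ub) (t := fun i => t (φ i)) (v := fun _ => w) (v' := w)
    (fun i => (ht0 _).ne') tendsto_const_nhds (fun i => hQs (φ i)) hQl hQ').2
  have hs' := hsw.change hQ hQ'
  have h1 := (hp k).sub (hp j)
  rw [hs' k k hjk.symm hjk.symm, hs' j j rfl rfl, if_pos rfl, if_pos rfl, sub_self] at h1
  have h2 : Tendsto (fun i => (lam (ub + t (φ i) • w) k - lam (ub + t (φ i) • w) j) / t (φ i)) atTop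
      (𝓝 0) := by
    have := (Complex.continuous_re.tendsto _).comp h1
    rw [Complex.zero_re] at this
    refine this.congr fun i => ?_
    have e : ((lam (ub + t (φ i) • w) k : ℂ) - lam ub k) / t (φ i) -
        ((lam (ub + t (φ i) • w) j : ℂ) - lam ub j) / t (φ i) =
        (((lam (ub + t (φ i) • w) k - lam (ub + t (φ i) • w) j) / t (φ i) : ℝ) : ℂ) := by
      rw [hjk]; push_cast; ring
    simp only [Function.comp_apply]
    rw [e, Complex.ofReal_re]
  have h3 : c ≤ 0 := ge_of_tendsto' h2 fun i => by
    rw [le_div_iff₀ (ht0 _)]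
    exact (hgε _ (ht0 _) ((htle _).trans_le (min_le_left _ _))).le
  linarith

theorem conical_isolated (hH0 : H0.IsHermitian) (hHc : ∀ i, (Hc i).IsHermitian)
    (hU : IsOpen U) (hlam : IsOrderedSpectrum H0 Hc U lam) {ub : EuclideanSpace ℝ (Fin m)}
    {j k : Fin n} (hne : j ≠ k) (hcon : ConicalAt U lam j k ub) :
    ∀ᶠ u in 𝓝[≠] ub, lam u j ≠ lam u k := by
  by_contra hnot
  rw [Filter.not_eventually] at hnot
  have hub := hcon.1
  have hUe : ∀ᶠ u in 𝓝[≠] ub, u ∈ U := nhdsWithin_le_nhds (hU.mem_nhds hub)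
  have hfr := (hnot.and_eventually (hUe.and self_mem_nhdsWithin))
  obtain ⟨us, hus, hp⟩ := exists_seq_forall_of_frequently hfr
  have hul : Tendsto us atTop (𝓝 ub) := tendsto_nhds_of_tendsto_nhdsWithin hus
  have heq : ∀ i, lam (us i) j = lam (us i) k := fun i => by
    have := (hp i).1; push Not at this; exact this
  have hUs : ∀ i, us i ∈ U := fun i => (hp i).2.1
  have hnz : ∀ i, us i - ub ≠ 0 := fun i => sub_ne_zero.2 (hp i).2.2
  let w : ℕ → EuclideanSpace ℝ (Fin m) := fun i => ‖us i - ub‖⁻¹ • (us i - ub)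
  have hw1 : ∀ i, w i ∈ Metric.sphere (0 : EuclideanSpace ℝ (Fin m)) 1 := fun i => by
    rw [mem_sphere_zero_iff_norm, norm_smul, norm_inv, norm_norm,
      inv_mul_cancel₀ (norm_ne_zero_iff.2 (hnz i))]
  have huw : ∀ i, us i = ub + ‖us i - ub‖ • w i := fun i => by
    simp only [w]
    rw [smul_smul, mul_inv_cancel₀ (norm_ne_zero_iff.2 (hnz i)), one_smul, add_sub_cancel]
  obtain ⟨w', hw', φ, hφ, hwl⟩ := (isCompact_sphere (0 : EuclideanSpace ℝ (Fin m)) 1).tendsto_subseq hw1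
  choose Qs hQs using fun i => dg_exists hH0 hHc hlam (hUs i)
  obtain ⟨ψ, hψ, Q', hQl, hQ', -⟩ := dg_limit hlam hub (fun i => hUs (φ i))
    (hul.comp hφ.tendsto_atTop) (fun i => hQs (φ i))
  have hpp := pert (H0 := H0) (Hc := Hc) (lam := lam) (ub := ub)
    (t := fun i => ‖us (φ (ψ i)) - ub‖) (v := fun i => w (φ (ψ i)))
    (v' := w') (fun i => norm_ne_zero_iff.2 (hnz _)) (hwl.comp hψ.tendsto_atTop)
    (Q := fun i => Qs (φ (ψ i))) (fun i => by
      rw [← huw]; exact hQs _) hQl hQ'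
  have hwne : w' ≠ 0 := by
    intro h0
    rw [h0, mem_sphere_zero_iff_norm, norm_zero] at hw'
    exact zero_ne_one hw'
  have hd : (star Q' * VV Hc w' * Q') j j = (star Q' * VV Hc w' * Q') k k := by
    refine tendsto_nhds_unique (hpp.2 j) ((hpp.2 k).congr fun i => ?_)
    rw [← huw, heq, hcon.2.1]
  refine conical_not_scal hH0 hHc hU hlam hcon hQ' hwne ((star Q' * VV Hc w' * Q') j j) ?_
  intro a b ha hb
  split_ifs with hab
  · subst hab
    rcases (hcon.2.2.1 a).1 ha with rfl | rfl
    · rfl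
    · exact hd.symm
  · exact hpp.1 a b hab (ha.trans hb.symm)

/-- The set of spectral degeneracies. -/
def degSet {n m : ℕ} (U : Set (EuclideanSpace ℝ (Fin m)))
    (lam : EuclideanSpace ℝ (Fin m) → Fin n → ℝ) : Set (EuclideanSpace ℝ (Fin m)) :=
  {u | u ∈ U ∧ ∃ j k : Fin n, (j : ℕ) + 1 = (k : ℕ) ∧ lam u j = lam u k}

theorem degSet_countable (hH0 : H0.IsHermitian) (hHc : ∀ i, (Hc i).IsHermitian)
    (hU : IsOpen U) (hlam : IsOrderedSpectrum H0 Hc U lam) (hcc : ConicallyConnected U lam) :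
    (degSet U lam).Countable := by
  have h1 : ∀ j k : Fin n, (j : ℕ) + 1 = (k : ℕ) → {u | u ∈ U ∧ lam u j = lam u k}.Countable := by
    intro j k hjk
    have hne : j ≠ k := by rintro rfl; omega
    have hd : DiscreteTopology {u | u ∈ U ∧ lam u j = lam u k} := by
      rw [discreteTopology_subtype_iff]
      rintro u ⟨hu, he⟩
      have := conical_isolated hH0 hHc hU hlam hne (hcc.1 u hu j k hjk he)
      rw [Filter.inf_principal_eq_bot]
      filter_upwards [this] with x hx hx2
      exact hx hx2.2
    have : Countable {u | u ∈ U ∧ lam u j = lam u k} := countable_of_Lindelof_of_discrete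
    exact Set.countable_coe_iff.1 this
  have h2 : degSet U lam ⊆ ⋃ j : Fin n, ⋃ k : Fin n, ⋃ _ : (j : ℕ) + 1 = (k : ℕ),
      {u | u ∈ U ∧ lam u j = lam u k} := by
    rintro u ⟨hu, j, k, hjk, he⟩
    simp only [Set.mem_iUnion]
    exact ⟨j, k, hjk, hu, he⟩
  refine Set.Countable.mono h2 ?_
  exact Set.countable_iUnion fun j => Set.countable_iUnion fun k => Set.countable_iUnion fun h => h1 j k h

theorem strictMono_of_reg (hlam : IsOrderedSpectrum H0 Hc U lam) {u : EuclideanSpace ℝ (Fin m)}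
    (hu : u ∈ U \ degSet U lam) : StrictMono (lam u) := by
  have hm := (hlam u hu.1).1
  intro a b hab
  refine lt_of_le_of_ne (hm hab.le) fun he => hu.2 ?_
  have hlt : (a : ℕ) + 1 < n := by have := b.2; have : (a:ℕ) < b := hab; omega
  refine ⟨hu.1, a, ⟨a + 1, hlt⟩, rfl, le_antisymm (hm ?_) ?_⟩
  · rw [Fin.le_def]; simp
  · rw [he]
    apply hm
    rw [Fin.le_def]
    exact hab

end Perturb

end

section

attribute [local instance] Matrix.normedAddCommGroup Matrix.normedSpace

open NormedSpace Filter Topology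

section PropA

variable {n m : ℕ} {H0 : CMat n} {Hc : Fin m → CMat n}
  {U : Set (EuclideanSpace ℝ (Fin m))} {lam : EuclideanSpace ℝ (Fin m) → Fin n → ℝ}

/-- The generators. -/
def gens {n m : ℕ} (H0 : CMat n) (Hc : Fin m → CMat n) (U : Set (EuclideanSpace ℝ (Fin m))) :
    Set (CMat n) :=
  {X | ∃ u ∈ U, X = (-Complex.I) • controlHam H0 Hc u}

theorem skew_of_herm {H : CMat n} (hH : H.IsHermitian) :
    star ((-Complex.I) • H) = -((-Complex.I) • H) := by
  rw [star_smul, Matrix.star_eq_conjTranspose, hH.eq]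
  simp

theorem gens_skew (hH0 : H0.IsHermitian) (hHc : ∀ i, (Hc i).IsHermitian) :
    ∀ X ∈ gens H0 Hc U, star X = -X := by
  rintro _ ⟨u, -, rfl⟩
  exact skew_of_herm (controlHam_herm hH0 hHc u)

/-- Conjugation by a unitary as a linear map. -/
def conjMap (Q : CMat n) : CMat n →ₗ[ℝ] CMat n where
  toFun A := Q * A * star Q
  map_add' A B := by rw [mul_add, add_mul]
  map_smul' c A := by simp

theorem conjMap_apply (Q A : CMat n) : conjMap Q A = Q * A * star Q := rfl

theorem comap_bracket {XX : Set (CMat n)} (hX : ∀ X ∈ XX, star X = -X) {Q : CMat n}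
    (hQ : Q ∈ Matrix.unitaryGroup (Fin n) ℂ) :
    ∀ A ∈ (ctlL XX).comap (conjMap Q), ∀ B ∈ (ctlL XX).comap (conjMap Q),
      A * B - B * A ∈ (ctlL XX).comap (conjMap Q) := by
  intro A hA B hB
  rw [Submodule.mem_comap, conjMap_apply] at *
  have := ctlL_bracket hX hA hB
  have h1 := Matrix.mem_unitaryGroup_iff'.1 hQ
  have e : ∀ A B : CMat n, Q * A * star Q * (Q * B * star Q) = Q * (A * B) * star Q := by
    intro A B
    calc _ = Q * A * (star Q * Q) * B * star Q := by simp only [mul_assoc]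
      _ = _ := by rw [h1]; simp only [mul_assoc, one_mul]
  rw [e, e, ← sub_mul, ← mul_sub] at this
  exact this

/-- The property propagated along the regular set. -/
def propA {n m : ℕ} (H0 : CMat n) (Hc : Fin m → CMat n) (U : Set (EuclideanSpace ℝ (Fin m)))
    (lam : EuclideanSpace ℝ (Fin m) → Fin n → ℝ) (j k : Fin n) :
    Set (EuclideanSpace ℝ (Fin m)) :=
  {u | ∃ Q, DgAt (controlHam H0 Hc u) (lam u) Q ∧
    ∀ z, Q * Ez j k z * star Q ∈ ctlL (gens H0 Hc U)}

theorem propA_closed (hlam : IsOrderedSpectrum H0 Hc U lam) (j k : Fin n)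
    {u : EuclideanSpace ℝ (Fin m)} (hu : u ∈ U)
    (hf : ∃ᶠ v in 𝓝 u, v ∈ U ∧ v ∈ propA H0 Hc U lam j k) : u ∈ propA H0 Hc U lam j k := by
  obtain ⟨us, hus, hp⟩ := exists_seq_forall_of_frequently hf
  choose hU Q hQ hz using hp
  obtain ⟨φ, hφ, Q', hQl, hQ', -⟩ := dg_limit hlam hu hU hus hQ
  refine ⟨Q', hQ', fun z => ?_⟩
  have hstar : Tendsto (fun i => star (Q (φ i))) atTop (𝓝 (star Q')) :=
    ((continuous_star (R := CMat n)).tendsto Q').comp hQl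
  have hlim : Tendsto (fun i => Q (φ i) * Ez j k z * star (Q (φ i))) atTop
      (𝓝 (Q' * Ez j k z * star Q')) := (hQl.mul tendsto_const_nhds).mul hstar
  exact ctlL_closed.mem_of_tendsto hlim (Eventually.of_forall fun i => hz (φ i) z)

theorem frob_sub_re (A B : CMat n) : ((A - B) * star (A - B)).trace.re =
    (A * star A).trace.re + (B * star B).trace.re - 2 * (A * star B).trace.re := by
  have h : (B * star A).trace.re = (A * star B).trace.re := by
    have : B * star A = star (A * star B) := by simp
    rw [this, Matrix.star_eq_conjTranspose, Matrix.trace_conjTranspose]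
    simp
  rw [star_sub, sub_mul, mul_sub, mul_sub]
  simp only [Matrix.trace_sub, Complex.sub_re]
  rw [h]; ring

theorem diag_of_commute {l : Fin n → ℝ} (hl : Function.Injective l) {Y : CMat n}
    (h : Y * Matrix.diagonal (fun i => (l i : ℂ)) = Matrix.diagonal (fun i => (l i : ℂ)) * Y) :
    Y = Matrix.diagonal (fun i => Y i i) := by
  ext a b
  by_cases hab : a = b
  · subst hab; simp
  · rw [Matrix.diagonal_apply_ne _ hab]
    have := congrFun (congrFun h a) b
    rw [Matrix.diagonal_mul, Matrix.mul_diagonal] at this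
    have h2 : ((l a : ℂ) - l b) * Y a b = 0 := by linear_combination -this
    rcases mul_eq_zero.1 h2 with h3 | h3
    · exact absurd (hl (by exact_mod_cast sub_eq_zero.1 h3)) hab
    · exact h3

theorem propA_open (hH0 : H0.IsHermitian) (hHc : ∀ i, (Hc i).IsHermitian)
    (hlam : IsOrderedSpectrum H0 Hc U lam) (j k : Fin n)
    {u0 : EuclideanSpace ℝ (Fin m)} (hu0 : u0 ∈ U) (hmono : StrictMono (lam u0))
    (hA : u0 ∈ propA H0 Hc U lam j k) :
    ∀ᶠ u in 𝓝 u0, u ∈ U → u ∈ propA H0 Hc U lam j k := by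
  have hX := gens_skew (U := U) hH0 hHc
  obtain ⟨Q0, hQ0, hz⟩ := hA
  have uu := Matrix.mem_unitaryGroup_iff.1 hQ0.1
  have uu' := Matrix.mem_unitaryGroup_iff'.1 hQ0.1
  let F : EuclideanSpace ℝ (Fin m) → ℝ := fun u =>
    ((controlHam H0 Hc u - controlHam H0 Hc u0) *
      star (controlHam H0 Hc u - controlHam H0 Hc u0)).trace.re
  have hFc : Continuous F := by
    have h1 : Continuous (fun u => controlHam H0 Hc u - controlHam H0 Hc u0) :=
      controlHam_cont.sub continuous_const
    have h2 : Continuous (fun u => (controlHam H0 Hc u - controlHam H0 Hc u0) *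
      star (controlHam H0 Hc u - controlHam H0 Hc u0)) := h1.mul h1.star
    exact Complex.continuous_re.comp h2.matrix_trace
  have hF0 : F u0 = 0 := by simp [F]
  have hev : ∀ᶠ u in 𝓝 u0, ∀ a b, a < b → F u < ((lam u0 b - lam u0 a) / 2) ^ 2 := by
    rw [eventually_all]; intro a
    rw [eventually_all]; intro b
    by_cases hab : a < b
    · have : F u0 < ((lam u0 b - lam u0 a) / 2) ^ 2 := by
        rw [hF0]
        have := hmono hab
        have : 0 < (lam u0 b - lam u0 a) / 2 := by linarith
        positivity
      filter_upwards [(hFc.tendsto u0).eventually_lt_const this] with u hu _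
      exact hu
    · exact Eventually.of_forall fun u h => absurd h hab
  filter_upwards [hev] with u hgap hu
  obtain ⟨g, hg, hcomm, hmax⟩ := hunt hX (ctlL_gen ⟨u, hu, rfl⟩) (ctlL_gen ⟨u0, hu0, rfl⟩)
  have hgu := ctlG_unitary hX hg
  have g1 := Matrix.mem_unitaryGroup_iff.1 hgu
  have g1' := Matrix.mem_unitaryGroup_iff'.1 hgu
  set H := controlHam H0 Hc u with hHdef
  set K := controlHam H0 Hc u0 with hKdef
  have hHh : star H = H := controlHam_herm hH0 hHc u
  have hcomm' : (g * H * star g) * K = K * (g * H * star g) := by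
    have hI : (-Complex.I * -Complex.I) ≠ 0 := by simp
    have h2 : (-Complex.I * -Complex.I) • ((g * H * star g) * K) =
        (-Complex.I * -Complex.I) • (K * (g * H * star g)) := by
      simpa [Matrix.mul_smul, Matrix.smul_mul, smul_smul] using hcomm
    exact smul_right_injective _ hI h2
  have hmax' : (H * star K).trace.re ≤ ((g * H * star g) * star K).trace.re := by
    simpa [Matrix.mul_smul, Matrix.smul_mul, smul_smul] using hmax
  set Y := star Q0 * (g * H * star g) * Q0 with hY
  have hYc : Y * Matrix.diagonal (fun i => (lam u0 i : ℂ)) =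
      Matrix.diagonal (fun i => (lam u0 i : ℂ)) * Y := by
    rw [← hQ0.conj_eq, hY]
    calc _ = star Q0 * ((g * H * star g) * (Q0 * star Q0) * K) * Q0 := by simp only [mul_assoc]
      _ = star Q0 * (K * (Q0 * star Q0) * (g * H * star g)) * Q0 := by
        rw [uu, mul_one, mul_one, hcomm']
      _ = _ := by simp only [mul_assoc]
  have hYd := diag_of_commute hmono.injective hYc
  have hYs : star Y = Y := by
    rw [hY]; simp only [star_mul, star_star, hHh, mul_assoc]
  have hYr : ∀ i, ((Y i i).re : ℂ) = Y i i := by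
    intro i
    have := congrFun (congrFun hYs i) i
    rw [Matrix.star_apply] at this
    exact Complex.conj_eq_iff_re.1 this
  let d : Fin n → ℝ := fun i => (Y i i).re
  have hYd' : Y = Matrix.diagonal (fun i => (d i : ℂ)) := by
    rw [hYd]
    congr 1
    funext i
    exact (hYr i).symm
  have hgH : g * H * star g = Q0 * Y * star Q0 := by
    rw [hY]
    calc _ = (Q0 * star Q0) * (g * H * star g) * (Q0 * star Q0) := by rw [uu]; simp
      _ = _ := by simp only [mul_assoc]
  have hdg : DgAt H d (star g * Q0) := by
    refine ⟨mul_mem (Unitary.star_mem hgu) hQ0.1, ?_⟩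
    rw [← hYd', star_mul, star_star]
    calc H = (star g * g) * H * (star g * g) := by rw [g1']; simp
      _ = star g * (g * H * star g) * g := by simp only [mul_assoc]
      _ = _ := by rw [hgH]; simp only [mul_assoc]
  have hfro : ∑ i, (d i - lam u0 i) ^ 2 ≤ F u := by
    have e1 : ((Y - Matrix.diagonal (fun i => (lam u0 i : ℂ))) *
        star (Y - Matrix.diagonal (fun i => (lam u0 i : ℂ)))).trace.re =
        ∑ i, (d i - lam u0 i) ^ 2 := by
      rw [hYd', Matrix.diagonal_sub, Matrix.star_eq_conjTranspose,
        Matrix.diagonal_conjTranspose, Matrix.diagonal_mul_diagonal, Matrix.trace_diagonal,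
        Complex.re_sum]
      refine Finset.sum_congr rfl fun i _ => ?_
      simp [sq]
    have e2 : (Y - Matrix.diagonal (fun i => (lam u0 i : ℂ))) *
        star (Y - Matrix.diagonal (fun i => (lam u0 i : ℂ))) =
        star Q0 * ((g * H * star g - K) * star (g * H * star g - K)) * star (star Q0) := by
      have : Y - Matrix.diagonal (fun i => (lam u0 i : ℂ)) = star Q0 * (g * H * star g - K) * Q0 := by
        rw [← hQ0.conj_eq, hY, mul_sub, sub_mul]
      rw [this, star_mul, star_mul, star_star]
      calc _ = star Q0 * (g * H * star g - K) * (Q0 * star Q0) * star (g * H * star g - K) * Q0 := by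
            simp only [mul_assoc]
        _ = _ := by rw [uu]; simp only [mul_assoc, one_mul]
    rw [← e1, e2, trace_conj (Unitary.star_mem hQ0.1), frob_sub_re]
    show _ ≤ ((H - K) * star (H - K)).trace.re
    rw [frob_sub_re]
    have e3 : (g * H * star g * star (g * H * star g)).trace = (H * star H).trace := by
      rw [← trace_conj hgu (H * star H)]
      congr 1
      rw [star_mul, star_mul, star_star]
      calc _ = g * H * (star g * g) * star H * star g := by simp only [mul_assoc]
        _ = _ := by rw [g1']; simp only [mul_assoc, one_mul]
    rw [e3]
    linarith
  have hdi : ∀ i, (d i - lam u0 i) ^ 2 ≤ F u := fun i =>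
    (Finset.single_le_sum (f := fun i => (d i - lam u0 i) ^ 2) (fun _ _ => sq_nonneg _)
      (Finset.mem_univ i)).trans hfro
  have hdm : StrictMono d := by
    intro a b hab
    have h0 := hmono hab
    have hlt := hgap a b hab
    have ha := abs_lt_of_sq_lt_sq ((hdi a).trans_lt hlt) (by linarith)
    have hb := abs_lt_of_sq_lt_sq ((hdi b).trans_lt hlt) (by linarith)
    rw [abs_lt] at ha hb
    linarith
  have hdl := dg_unique hlam hu hdm.monotone hdg
  rw [hdl] at hdg
  refine ⟨star g * Q0, hdg, fun z => ?_⟩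
  have := ctlL_conj (ctlG_star hX hg) (hz z)
  rw [star_star] at this
  rw [star_mul, star_star]
  simpa only [mul_assoc] using this

theorem propA_common {j k : Fin n} {u : EuclideanSpace ℝ (Fin m)} (hinj : Function.Injective (lam u))
    (hA : u ∈ propA H0 Hc U lam j k) {Q : CMat n} (hQ : DgAt (controlHam H0 Hc u) (lam u) Q)
    (z : ℂ) : Q * Ez j k z * star Q ∈ ctlL (gens H0 Hc U) := by
  obtain ⟨Q', hQ', hz⟩ := hA
  have u1 := Matrix.mem_unitaryGroup_iff.1 hQ.1
  have u2 := Matrix.mem_unitaryGroup_iff.1 hQ'.1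
  set C := star Q' * Q with hC
  have hCu : star C * C = 1 := by
    rw [hC, star_mul, star_star]
    calc _ = star Q * (Q' * star Q') * Q := by simp only [mul_assoc]
      _ = 1 := by rw [u2, mul_one]; exact Matrix.mem_unitaryGroup_iff'.1 hQ.1
  have hcomm : C * Matrix.diagonal (fun i => (lam u i : ℂ)) = Matrix.diagonal (fun i => (lam u i : ℂ)) * C := by
    symm
    calc _ = star Q' * controlHam H0 Hc u * (Q' * star Q') * Q := by
          rw [← hQ'.conj_eq, hC]; simp only [mul_assoc]
      _ = star Q' * ((Q * star Q) * controlHam H0 Hc u * Q) := by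
        rw [u1, u2]; simp only [mul_assoc, one_mul, mul_one]
      _ = _ := by rw [← hQ.conj_eq, hC]; simp only [mul_assoc]
  have hCd := diag_of_commute hinj hcomm
  have hQC : Q = Q' * C := by rw [hC, ← mul_assoc, u2, one_mul]
  have hconj : C * Ez j k z * star C = Ez j k (C j j * z * star (C k k)) := by
    rw [hCd, Matrix.star_eq_conjTranspose, Matrix.diagonal_conjTranspose]
    ext a b
    rw [Matrix.mul_diagonal, Matrix.diagonal_mul]
    simp only [Ez, Matrix.sub_apply, Matrix.single_apply, Pi.star_apply, Matrix.diagonal_apply_eq]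
    by_cases h1 : j = a ∧ k = b <;> by_cases h2 : k = a ∧ j = b
    · obtain ⟨rfl, rfl⟩ := h1
      obtain ⟨rfl, -⟩ := h2
      simp; ring
    · obtain ⟨rfl, rfl⟩ := h1
      simp [h2]
    · obtain ⟨rfl, rfl⟩ := h2
      simp [h1]; ring
    · simp [h1, h2]
  rw [hQC, star_mul]
  have : Q' * C * Ez j k z * (star C * star Q') = Q' * (C * Ez j k z * star C) * star Q' := by
    simp only [mul_assoc]
  rw [this, hconj]
  exact hz _

end PropA

end

section

attribute [local instance] Matrix.normedAddCommGroup Matrix.normedSpace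

open NormedSpace Filter Topology

section Local

variable {n m : ℕ} {H0 : CMat n} {Hc : Fin m → CMat n}
  {U : Set (EuclideanSpace ℝ (Fin m))} {lam : EuclideanSpace ℝ (Fin m) → Fin n → ℝ}

theorem conj_VV_real (hHc : ∀ i, (Hc i).IsHermitian) (v : EuclideanSpace ℝ (Fin m)) (Q : CMat n)
    (a b : Fin n) :
    (star Q * VV Hc v * Q) b a = star ((star Q * VV Hc v * Q) a b) := by
  have h : star (star Q * VV Hc v * Q) = star Q * VV Hc v * Q := by
    have := (VV_herm hHc v).eq
    rw [← Matrix.star_eq_conjTranspose] at this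
    simp only [star_mul, star_star, this, mul_assoc]
  have := congrFun (congrFun h b) a
  rw [Matrix.star_apply] at this
  exact this.symm

theorem VV_mem (hU : IsOpen U) {u : EuclideanSpace ℝ (Fin m)} (hu : u ∈ U)
    (w : EuclideanSpace ℝ (Fin m)) : (-Complex.I) • VV Hc w ∈ ctlL (gens H0 Hc U) := by
  have hev : ∀ᶠ t : ℝ in 𝓝 0, u + t • w ∈ U := by
    have hc : ContinuousAt (fun t : ℝ => u + t • w) 0 := by fun_prop
    refine hc.eventually_mem (hU.mem_nhds ?_)
    simpa using hu
  obtain ⟨δ, hδ, hδU⟩ := Metric.eventually_nhds_iff.1 hev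
  have h1 : u + (δ / 2) • w ∈ U := hδU (by
    rw [Real.dist_0_eq_abs, abs_of_pos (by positivity)]; linarith)
  have hX1 : (-Complex.I) • controlHam H0 Hc (u + (δ / 2) • w) ∈ ctlL (gens H0 Hc U) :=
    ctlL_gen ⟨_, h1, rfl⟩
  have hX2 : (-Complex.I) • controlHam H0 Hc u ∈ ctlL (gens H0 Hc U) :=
    ctlL_gen ⟨_, hu, rfl⟩
  have h3 := Submodule.smul_mem _ (δ / 2)⁻¹ (Submodule.sub_mem _ hX1 hX2)
  have e : (-Complex.I) • VV Hc w = (δ / 2)⁻¹ • ((-Complex.I) • controlHam H0 Hc (u + (δ / 2) • w) -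
      (-Complex.I) • controlHam H0 Hc u) := by
    rw [controlHam_add, smul_add, add_sub_cancel_left]
    ext a b
    simp only [Matrix.smul_apply, smul_eq_mul, Complex.real_smul]
    have : (δ : ℂ) ≠ 0 := by exact_mod_cast hδ.ne'
    push_cast
    field_simp
  rw [e]
  exact h3

theorem ev_ne {α : Type*} {l : Filter α} {f g : α → ℝ} {a b : ℝ} (hf : Tendsto f l (𝓝 a))
    (hg : Tendsto g l (𝓝 b)) (hab : a ≠ b) : ∀ᶠ x in l, f x ≠ g x := by
  have h := (hf.sub hg).eventually_ne (sub_ne_zero.2 hab)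
  filter_upwards [h] with x hx
  exact sub_ne_zero.1 hx

theorem loc_exists (hm : 2 ≤ m) (hH0 : H0.IsHermitian) (hHc : ∀ i, (Hc i).IsHermitian)
    (hU : IsOpen U) (hlam : IsOrderedSpectrum H0 Hc U lam) (hcc : ConicallyConnected U lam)
    {j k : Fin n} (hjk : (j : ℕ) + 1 = (k : ℕ)) :
    ∃ u ∈ U \ degSet U lam, u ∈ propA H0 Hc U lam j k := by
  have hX := gens_skew (U := U) hH0 hHc
  obtain ⟨ub, hcon, hsimp⟩ := hcc.2 j k hjk
  have hne : j ≠ k := by rintro rfl; omega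
  have hub := hcon.1
  have heqb : ∀ a b, lam ub a = lam ub b → a = b ∨ (a = j ∧ b = k) ∨ (a = k ∧ b = j) := by
    intro a b hab
    by_cases ha : a = j
    · subst ha
      rcases (hcon.2.2.1 b).1 hab.symm with h | h
      · exact Or.inl h.symm
      · exact Or.inr (Or.inl ⟨rfl, h⟩)
    by_cases ha' : a = k
    · subst ha'
      rcases (hcon.2.2.1 b).1 (hab.symm.trans hcon.2.1.symm) with h | h
      · exact Or.inr (Or.inr ⟨rfl, h⟩)
      · exact Or.inl h.symm
    · exact Or.inl (hsimp a ha ha' b hab.symm).symm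
  have hlc : ∀ a, Tendsto (fun u => lam u a) (𝓝 ub) (𝓝 (lam ub a)) := fun a =>
    tendsto_pi_nhds.1 (lam_cont hH0 hHc hU hlam hub) a
  -- punctured neighbourhoods
  have hreg : ∀ᶠ u in 𝓝[≠] ub, u ∈ U \ degSet U lam := by
    have h1 : ∀ᶠ u in 𝓝[≠] ub, u ∈ U := nhdsWithin_le_nhds (hU.mem_nhds hub)
    have h2 : ∀ᶠ u in 𝓝[≠] ub, ∀ a b : Fin n, (a : ℕ) + 1 = (b : ℕ) → lam u a ≠ lam u b := by
      rw [eventually_all]; intro a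
      rw [eventually_all]; intro b
      by_cases hab : lam ub a = lam ub b
      · rcases heqb a b hab with rfl | ⟨rfl, rfl⟩ | ⟨rfl, rfl⟩
        · exact Eventually.of_forall fun u h => by omega
        · filter_upwards [conical_isolated hH0 hHc hU hlam hne hcon] with u hu _ using hu
        · exact Eventually.of_forall fun u h => by omega
      · have h3 : ∀ᶠ u in 𝓝 ub, lam u a ≠ lam u b := ev_ne (hlc a) (hlc b) hab
        filter_upwards [nhdsWithin_le_nhds h3] with u hu _ using hu
    filter_upwards [h1, h2] with u hu1 hu2
    refine ⟨hu1, ?_⟩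
    rintro ⟨-, a, b, hab, he⟩
    exact hu2 a b hab he
  have hgap : ∀ᶠ u in 𝓝[≠] ub, ∀ a b : Fin n, ¬ (a = j ∧ b = k) → ¬ (a = k ∧ b = j) →
      (lam u a - lam u b) ^ 2 ≠ (lam u j - lam u k) ^ 2 := by
    rw [eventually_all]; intro a
    rw [eventually_all]; intro b
    by_cases hab : lam ub a = lam ub b
    · rcases heqb a b hab with rfl | ⟨rfl, rfl⟩ | ⟨rfl, rfl⟩
      · filter_upwards [conical_isolated hH0 hHc hU hlam hne hcon] with u hu _ _
        rw [sub_self]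
        have : lam u j - lam u k ≠ 0 := sub_ne_zero.2 hu
        have := pow_ne_zero 2 this
        simpa using this.symm
      · exact Eventually.of_forall fun u h => absurd ⟨rfl, rfl⟩ h
      · exact Eventually.of_forall fun u _ h => absurd ⟨rfl, rfl⟩ h
    · have h3 : ∀ᶠ u in 𝓝 ub, (lam u a - lam u b) ^ 2 ≠ (lam u j - lam u k) ^ 2 := by
        refine ev_ne (((hlc a).sub (hlc b)).pow 2) (((hlc j).sub (hlc k)).pow 2) ?_
        rw [hcon.2.1, sub_self]
        have := pow_ne_zero 2 (sub_ne_zero.2 hab)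
        simpa using this
      filter_upwards [nhdsWithin_le_nhds h3] with u hu _ _ using hu
  -- the sequence
  let v : EuclideanSpace ℝ (Fin m) := EuclideanSpace.single ⟨0, by omega⟩ 1
  let w : EuclideanSpace ℝ (Fin m) := EuclideanSpace.single ⟨1, by omega⟩ 1
  have hv : v ≠ 0 := by
    intro h
    have := congrArg (fun x : EuclideanSpace ℝ (Fin m) => x ⟨0, by omega⟩) h
    simp [v] at this
  have hwv : ∀ s : ℝ, w + s • v ≠ 0 := by
    intro s h
    have := congrArg (fun x : EuclideanSpace ℝ (Fin m) => x ⟨1, by omega⟩) h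
    simp [v, w] at this
  have hpath : Tendsto (fun t : ℝ => ub + t • v) (𝓝[≠] 0) (𝓝[≠] ub) := by
    rw [tendsto_nhdsWithin_iff]
    constructor
    · have hc : Continuous (fun t : ℝ => ub + t • v) := by fun_prop
      have := hc.tendsto 0
      rw [zero_smul, add_zero] at this
      exact this.mono_left nhdsWithin_le_nhds
    · filter_upwards [self_mem_nhdsWithin] with t ht
      simp only [Set.mem_compl_iff, Set.mem_singleton_iff, add_eq_left, smul_eq_zero, not_or]
      exact ⟨ht, hv⟩
  have hall := hpath.eventually ((hreg.and hgap))
  obtain ⟨t, ht, hp⟩ := exists_seq_forall_of_frequently (hall.and self_mem_nhdsWithin).frequently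
  have htU : ∀ i, ub + t i • v ∈ U := fun i => (hp i).1.1.1
  choose Qs hQs using fun i => dg_exists hH0 hHc hlam (htU i)
  have hul : Tendsto (fun i => ub + t i • v) atTop (𝓝 ub) :=
    tendsto_nhds_of_tendsto_nhdsWithin (hpath.comp ht)
  obtain ⟨φ, hφ, Q', hQl, hQ', -⟩ := dg_limit hlam hub htU hul hQs
  have hpe := (pert (lam := lam) (ub := ub) (t := fun i => t (φ i)) (v := fun _ => v) (v' := v)
    (fun i => (hp (φ i)).2) tendsto_const_nhds (fun i => hQs (φ i)) hQl hQ').1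
  have hscal : ∀ x : EuclideanSpace ℝ (Fin m), x ≠ 0 → (star Q' * VV Hc x * Q') j k = 0 →
      (star Q' * VV Hc x * Q') j j = (star Q' * VV Hc x * Q') k k → False := by
    intro x hx h1 h2
    refine conical_not_scal hH0 hHc hU hlam hcon hQ' hx ((star Q' * VV Hc x * Q') j j) ?_
    have h3 : (star Q' * VV Hc x * Q') k j = 0 := by rw [conj_VV_real hHc, h1, star_zero]
    intro a b ha hb
    rcases (hcon.2.2.1 a).1 ha with rfl | rfl <;> rcases (hcon.2.2.1 b).1 hb with rfl | rfl
    · simp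
    · rw [if_neg hne, h1]
    · rw [if_neg hne.symm, h3]
    · simp [h2]
  have hvjk := hpe j k hne hcon.2.1
  have hvd : (star Q' * VV Hc v * Q') j j ≠ (star Q' * VV Hc v * Q') k k :=
    fun h => hscal v hv hvjk h
  have hre : ∀ x a, ∃ r : ℝ, (star Q' * VV Hc x * Q') a a = r := by
    intro x a
    exact ⟨_, (Complex.conj_eq_iff_re.1 (conj_VV_real hHc x Q' a a).symm).symm⟩
  have hwjk : (star Q' * VV Hc w * Q') j k ≠ 0 := by
    intro h0
    obtain ⟨p, hp1⟩ := hre v j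
    obtain ⟨q, hq1⟩ := hre v k
    obtain ⟨p', hp2⟩ := hre w j
    obtain ⟨q', hq2⟩ := hre w k
    have hpq : p - q ≠ 0 := by
      intro h
      apply hvd
      rw [hp1, hq1, sub_eq_zero.1 h]
    have hlin : ∀ s : ℝ, star Q' * VV Hc (w + s • v) * Q' = star Q' * VV Hc w * Q' +
        (s : ℂ) • (star Q' * VV Hc v * Q') := by
      intro s
      rw [VV_add, VV_smul, mul_add, add_mul]
      simp
    refine hscal (w + (-(p' - q') / (p - q)) • v) (hwv _) ?_ ?_
    · rw [hlin, Matrix.add_apply, Matrix.smul_apply, h0, hvjk]; simp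
    · rw [hlin, Matrix.add_apply, Matrix.smul_apply, Matrix.add_apply, Matrix.smul_apply, hp1, hq1,
        hp2, hq2]
      simp only [smul_eq_mul]
      norm_cast
      field_simp
      ring
  have hstar : Tendsto (fun i => star (Qs (φ i))) atTop (𝓝 (star Q')) :=
    ((continuous_star (R := CMat n)).tendsto Q').comp hQl
  have hlim : Tendsto (fun i => star (Qs (φ i)) * VV Hc w * Qs (φ i)) atTop
      (𝓝 (star Q' * VV Hc w * Q')) := (hstar.mul tendsto_const_nhds).mul hQl
  obtain ⟨i, hi⟩ := ((tendsto_entry hlim j k).eventually_ne hwjk).exists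
  have hdgi := hQs (φ i)
  have hui := (hp (φ i)).1
  set u := ub + t (φ i) • v with hudef
  set Q := Qs (φ i) with hQdef
  refine ⟨u, hui.1, Q, hdgi, fun z => ?_⟩
  have uQ := Matrix.mem_unitaryGroup_iff.1 hdgi.1
  have hcancel : ∀ A : CMat n, Q * (star Q * A * Q) * star Q = A := by
    intro A
    calc _ = (Q * star Q) * A * (Q * star Q) := by simp only [mul_assoc]
      _ = A := by rw [uQ]; simp
  have hfin := lie_ext ((ctlL (gens H0 Hc U)).comap (conjMap Q)) (comap_bracket hX hdgi.1)
    (lam u) (B := star Q * ((-Complex.I) • VV Hc w) * Q) ?_ ?_ ?_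
    (hjk := (strictMono_of_reg hlam hui.1).injective.ne hne) hui.2 ?_ z
  · exact hfin
  · rw [Submodule.mem_comap, conjMap_apply]
    have e : (Matrix.diagonal (fun i => -Complex.I * (lam u i : ℂ)) : CMat n) =
        (-Complex.I) • Matrix.diagonal (fun i => (lam u i : ℂ)) := by
      rw [← Matrix.diagonal_smul]; rfl
    rw [e, Matrix.mul_smul, Matrix.smul_mul, ← hdgi.2]
    exact ctlL_gen ⟨u, hui.1.1, rfl⟩
  · rw [Submodule.mem_comap, conjMap_apply, hcancel]
    exact VV_mem hU hub w
  · have := skew_of_herm (VV_herm hHc w)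
    rw [star_mul, star_mul, star_star, this]
    simp [mul_assoc]
  · rw [Matrix.mul_smul, Matrix.smul_mul, Matrix.smul_apply]
    exact smul_ne_zero (by simp) hi

theorem hfull_main (hn : 2 ≤ n) (hm : 2 ≤ m) (hH0 : H0.IsHermitian) (hHc : ∀ i, (Hc i).IsHermitian)
    (hU : IsOpen U) (hUc : IsConnected U) (hlam : IsOrderedSpectrum H0 Hc U lam)
    (hcc : ConicallyConnected U lam) (Y : CMat n) (hY : star Y = -Y) (htr : Y.trace = 0) :
    Y ∈ ctlL (gens H0 Hc U) := by
  have hX := gens_skew (U := U) hH0 hHc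
  have hall : ∀ j k : Fin n, (j : ℕ) + 1 = (k : ℕ) → ∀ u ∈ U \ degSet U lam,
      u ∈ propA H0 Hc U lam j k := by
    intro j k hjk
    refine connect_lemma hm hU hUc.isPreconnected (degSet_countable hH0 hHc hU hlam hcc) ?_ ?_
      (loc_exists hm hH0 hHc hU hlam hcc hjk)
    · intro u hu hA
      filter_upwards [propA_open hH0 hHc hlam j k hu.1 (strictMono_of_reg hlam hu) hA] with v hv hv2
      exact hv hv2.1
    · intro u hu hf
      exact propA_closed hlam j k hu.1 (hf.mono fun v hv => ⟨hv.1.1, hv.2⟩)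
  obtain ⟨u, hu, -⟩ := loc_exists (j := ⟨0, by omega⟩) (k := ⟨1, by omega⟩) hm hH0 hHc hU hlam hcc
    (by simp)
  obtain ⟨Q, hQ⟩ := dg_exists hH0 hHc hlam hu.1
  have uQ := Matrix.mem_unitaryGroup_iff.1 hQ.1
  have hmem := lie_gen (by omega) ((ctlL (gens H0 Hc U)).comap (conjMap Q))
    (comap_bracket hX hQ.1) (fun j k hjk z =>
      propA_common (strictMono_of_reg hlam hu).injective (hall j k hjk u hu) hQ z)
    (Y := star Q * Y * Q) (by
      rw [star_mul, star_mul, star_star, hY]; simp [mul_assoc])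
    (by
      have := trace_conj (Unitary.star_mem hQ.1) Y
      rw [star_star] at this
      rw [this, htr])
  rw [Submodule.mem_comap, conjMap_apply] at hmem
  have e : Q * (star Q * Y * Q) * star Q = Y := by
    calc _ = (Q * star Q) * Y * (Q * star Q) := by simp only [mul_assoc]
      _ = Y := by rw [uQ]; simp
  rwa [e] at hmem

end Local

end

section

attribute [local instance] Matrix.normedAddCommGroup Matrix.normedSpace

open NormedSpace Filter Topology MeasureTheory

section Glue

theorem glue_traj {E : Type*} [NormedAddCommGroup E] [NormedSpace ℝ E] [CompleteSpace E]
    {F1 F2 F3 g1 g2 g3 : ℝ → E} {T τ : ℝ} (hT : 0 ≤ T) (hτ : 0 ≤ τ)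
    (h1 : IntervalIntegrable F1 volume 0 T)
    (hg1 : ∀ t ∈ Set.Icc 0 T, g1 t = g1 0 + ∫ s in (0:ℝ)..t, F1 s)
    (h2 : ∀ t, HasDerivAt g2 (F2 t) t) (hF2 : Continuous F2) (hgT : g2 T = g1 T)
    (hF31 : ∀ t, t ≤ T → F3 t = F1 t) (hF32 : ∀ t, T < t → F3 t = F2 t)
    (hg31 : ∀ t, t ≤ T → g3 t = g1 t) (hg32 : ∀ t, T < t → g3 t = g2 t) :
    IntervalIntegrable F3 volume 0 (T + τ) ∧
      ∀ t ∈ Set.Icc 0 (T + τ), g3 t = g3 0 + ∫ s in (0:ℝ)..t, F3 s := by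
  have hA : ∀ t, t ∈ Set.Icc 0 T → IntervalIntegrable F3 volume 0 t ∧
      ∫ s in (0:ℝ)..t, F3 s = ∫ s in (0:ℝ)..t, F1 s := by
    intro t ht
    have hsub : IntervalIntegrable F1 volume 0 t := h1.mono_set (by
      rw [Set.uIcc_of_le ht.1, Set.uIcc_of_le hT]; exact Set.Icc_subset_Icc_right ht.2)
    constructor
    · refine hsub.congr fun s hs => ?_
      rw [Set.uIoc_of_le ht.1] at hs
      exact (hF31 s (hs.2.trans ht.2)).symm
    · refine intervalIntegral.integral_congr fun s hs => ?_
      rw [Set.uIcc_of_le ht.1] at hs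
      exact hF31 s (hs.2.trans ht.2)
  have hB : ∀ t, T ≤ t → IntervalIntegrable F3 volume T t ∧
      ∫ s in T..t, F3 s = g2 t - g2 T := by
    intro t ht
    have hc := hF2.intervalIntegrable (μ := volume) T t
    have heq : ∀ s ∈ Set.uIoc T t, F2 s = F3 s := by
      intro s hs
      rw [Set.uIoc_of_le ht] at hs
      exact (hF32 s hs.1).symm
    constructor
    · exact hc.congr heq
    · rw [← intervalIntegral.integral_eq_sub_of_hasDerivAt (fun s _ => h2 s) hc]
      refine intervalIntegral.integral_congr_ae (Eventually.of_forall fun s hs => (heq s hs).symm)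
  refine ⟨(hA T ⟨hT, le_rfl⟩).1.trans (hB (T + τ) (by linarith)).1, fun t ht => ?_⟩
  rcases le_or_gt t T with htT | htT
  · rw [hg31 t htT, hg31 0 hT, hg1 t ⟨ht.1, htT⟩, (hA t ⟨ht.1, htT⟩).2]
  · rw [← intervalIntegral.integral_add_adjacent_intervals (hA T ⟨hT, le_rfl⟩).1 (hB t htT.le).1,
      (hA T ⟨hT, le_rfl⟩).2, (hB t htT.le).2, hg32 t htT, hg31 0 hT, hgT, hg1 T ⟨hT, le_rfl⟩]
    abel

variable {n m : ℕ} {H0 : CMat n} {Hc : Fin m → CMat n}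
  {U : Set (EuclideanSpace ℝ (Fin m))}

theorem reach_step (hH0 : H0.IsHermitian) (hHc : ∀ i, (Hc i).IsHermitian) {g0 h : CMat n}
    (hh : h ∈ liftedReachable U (controlHam H0 Hc) g0) {u0 : EuclideanSpace ℝ (Fin m)} (hu0 : u0 ∈ U)
    {τ : ℝ} (hτ : 0 ≤ τ) :
    exp (τ • ((-Complex.I) • controlHam H0 Hc u0)) * h ∈ liftedReachable U (controlHam H0 Hc) g0 := by
  classical
  obtain ⟨T, hT, u, g, ⟨hu1, hu2, C, hC⟩, ⟨hg1, hg2, hg3⟩, hg0, hgT⟩ := hh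
  set X := (-Complex.I) • controlHam H0 Hc u0 with hX
  have hXs : star X = -X := skew_of_herm (controlHam_herm hH0 hHc u0)
  let u' : ℝ → EuclideanSpace ℝ (Fin m) := fun t => if t ≤ T then u t else u0
  let g2 : ℝ → CMat n := fun t => exp ((t - T) • X) * g T
  let g' : ℝ → CMat n := fun t => if t ≤ T then g t else g2 t
  have hu'1 : ∀ t, t ≤ T → u' t = u t := fun t ht => if_pos ht
  have hu'2 : ∀ t, T < t → u' t = u0 := fun t ht => if_neg (not_le.2 ht)
  have hg'1 : ∀ t, t ≤ T → g' t = g t := fun t ht => if_pos ht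
  have hg'2 : ∀ t, T < t → g' t = g2 t := fun t ht => if_neg (not_le.2 ht)
  have hd : ∀ t, HasDerivAt g2 (X * exp ((t - T) • X) * g T) t := by
    intro t
    have h1 := (mat_exp_deriv' X (t - T)).hasDerivAt
    have h2 := h1.scomp t ((hasDerivAt_id t).sub_const T)
    have h3 : HasStrictDerivAt (fun t : ℝ => exp (t • X) * g T)
      (X * exp ((t - T) • X) * g T + exp ((t - T) • X) * 0) (t - T) :=
      mat_mul_deriv (mat_exp_deriv' X (t - T)) (hasStrictDerivAt_const (t - T) (g T))
    have h4 := h3.hasDerivAt.comp_sub_const t T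
    rw [mul_zero, add_zero] at h4
    exact h4
  have hcont : Continuous (fun t : ℝ => X * exp ((t - T) • X) * g T) := by
    have : Continuous (fun t : ℝ => exp (t • X)) := by
      refine continuous_iff_continuousAt.2 fun t => ?_
      exact (mat_exp_deriv' X t).hasDerivAt.continuousAt
    have h2 : Continuous (fun t : ℝ => exp ((t - T) • X)) :=
      this.comp (continuous_id.sub continuous_const)
    exact (continuous_const.mul h2).mul continuous_const
  have hglue := glue_traj (E := CMat n) (F1 := fun s => (-Complex.I) • (controlHam H0 Hc (u s) * g s))
    (F2 := fun t : ℝ => X * exp ((t - T) • X) * g T)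
    (F3 := fun s => (-Complex.I) • (controlHam H0 Hc (u' s) * g' s)) (g1 := g) (g2 := g2) (g3 := g')
    hT hτ hg2 hg3 hd hcont (by simp [g2]) (fun t ht => by simp only [hu'1 t ht, hg'1 t ht])
    (fun t ht => by
      simp only [hu'2 t ht, hg'2 t ht, g2, hX, Matrix.smul_mul, mul_assoc]) hg'1 hg'2
  refine ⟨T + τ, by linarith, u', g', ⟨?_, ?_, ?_⟩, ⟨?_, hglue.1, hglue.2⟩, ?_, ?_⟩
  · have e : Set.Icc 0 (T + τ) = Set.Icc 0 T ∪ Set.Ioc T (T + τ) :=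
      (Set.Icc_union_Ioc_eq_Icc hT (by linarith)).symm
    rw [e, aestronglyMeasurable_union_iff]
    constructor
    · refine hu1.congr ?_
      filter_upwards [ae_restrict_mem measurableSet_Icc] with t ht
      exact (hu'1 t ht.2).symm
    · refine (aestronglyMeasurable_const (b := u0)).congr ?_
      filter_upwards [ae_restrict_mem measurableSet_Ioc] with t ht
      exact (hu'2 t ht.1).symm
  · intro t ht
    rcases le_or_gt t T with h | h
    · rw [hu'1 t h]; exact hu2 t ⟨ht.1, h⟩
    · rw [hu'2 t h]; exact hu0
  · refine ⟨max C ‖u0‖, fun t ht => ?_⟩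
    rcases le_or_gt t T with h | h
    · rw [hu'1 t h]; exact (hC t ⟨ht.1, h⟩).trans (le_max_left _ _)
    · rw [hu'2 t h]; exact le_max_right _ _
  · intro t ht
    rcases le_or_gt t T with h | h
    · rw [hg'1 t h]; exact hg1 t ⟨ht.1, h⟩
    · rw [hg'2 t h]
      exact mul_mem (mat_exp_unitary (skew_smul hXs _)) (hg1 T ⟨hT, le_rfl⟩)
  · rw [hg'1 0 hT, hg0]
  · rcases hτ.eq_or_lt with h | h
    · subst h
      rw [hg'1 _ (by simp), add_zero, hgT]; simp
    · rw [hg'2 _ (by linarith)]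
      simp [g2, hgT]

theorem reach_base {g0 : CMat n} (hg0 : g0 ∈ Matrix.unitaryGroup (Fin n) ℂ) (hU : U.Nonempty) :
    g0 ∈ liftedReachable U (controlHam H0 Hc) g0 := by
  obtain ⟨u0, hu0⟩ := hU
  refine ⟨0, le_rfl, fun _ => u0, fun _ => g0, ⟨aestronglyMeasurable_const, fun _ _ => hu0,
    ‖u0‖, fun _ _ => le_rfl⟩, ⟨fun _ _ => hg0, IntervalIntegrable.refl, fun t ht => ?_⟩, rfl, rfl⟩
  have : t = 0 := le_antisymm ht.2 ht.1
  subst this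
  simp

theorem reach_all (hH0 : H0.IsHermitian) (hHc : ∀ i, (Hc i).IsHermitian) {g0 s : CMat n}
    (hg0 : g0 ∈ Matrix.unitaryGroup (Fin n) ℂ) (hU : U.Nonempty) (hs : s ∈ ctlS (gens H0 Hc U)) :
    s * g0 ∈ liftedReachable U (controlHam H0 Hc) g0 := by
  unfold ctlS at hs
  induction hs using Submonoid.closure_induction_left with
  | one => rw [one_mul]; exact reach_base hg0 hU
  | mul_left x hx y hy ih =>
    obtain ⟨X, ⟨u0, hu0, rfl⟩, τ, hτ, rfl⟩ := hx
    rw [mul_assoc]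
    exact reach_step hH0 hHc ih hu0 hτ

end Glue

end

section

attribute [local instance] Matrix.normedAddCommGroup Matrix.normedSpace

open NormedSpace Filter Topology MeasureTheory

section DetPres

variable {n m : ℕ} {H0 : CMat n} {Hc : Fin m → CMat n}
  {U : Set (EuclideanSpace ℝ (Fin m))}

theorem norm_mul_sup (A B : CMat n) : ‖A * B‖ ≤ n * ‖A‖ * ‖B‖ := by
  rw [Matrix.norm_le_iff (by positivity)]
  intro i j
  rw [Matrix.mul_apply]
  calc ‖∑ k, A i k * B k j‖ ≤ ∑ k : Fin n, ‖A‖ * ‖B‖ := by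
        refine norm_sum_le_of_le _ fun k _ => ?_
        rw [norm_mul]
        exact mul_le_mul (Matrix.norm_entry_le_entrywise_sup_norm A)
          (Matrix.norm_entry_le_entrywise_sup_norm B) (norm_nonneg _) (norm_nonneg _)
    _ = n * ‖A‖ * ‖B‖ := by simp [mul_assoc]

theorem norm_trace_sup (A : CMat n) : ‖A.trace‖ ≤ n * ‖A‖ := by
  calc ‖A.trace‖ ≤ ∑ k : Fin n, ‖A‖ := by
        refine norm_sum_le_of_le _ fun k _ => ?_
        exact Matrix.norm_entry_le_entrywise_sup_norm A
    _ = n * ‖A‖ := by simp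

theorem norm_unitary_sup {Q : CMat n} (hQ : Q ∈ Matrix.unitaryGroup (Fin n) ℂ) : ‖Q‖ ≤ 1 := by
  rw [Matrix.norm_le_iff zero_le_one]
  intro i j
  exact entry_norm_bound_of_unitary hQ i j

theorem det_differentiable : Differentiable ℂ (fun M : CMat n => M.det) := by
  have h : Differentiable ℂ (fun M : Fin n → Fin n → ℂ => Matrix.det (Matrix.of M)) := by
    simp only [Matrix.det_apply, Matrix.of_apply]
    fun_prop
  exact h

theorem det_littleO : (fun E : CMat n => (1 + E).det - 1 - E.trace) =o[𝓝 0] (fun E : CMat n => E) := by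
  have hd := (det_differentiable (n := n) (1 : CMat n)).hasFDerivAt
  set D := fderiv ℂ (fun M : CMat n => M.det) 1 with hD
  have hDt : ∀ E, D E = E.trace := by
    intro E
    have h1 : HasDerivAt (fun t : ℂ => (1 : CMat n) + t • E) E 0 := by
      have := ((hasDerivAt_id (0:ℂ)).smul_const E).const_add (1 : CMat n)
      rw [one_smul] at this
      exact this
    have hd' : HasFDerivAt (fun M : CMat n => M.det) D ((1 : CMat n) + (0:ℂ) • E) := by
      rw [zero_smul, add_zero]; exact hd
    have h2 : HasDerivAt (fun t : ℂ => ((1 : CMat n) + t • E).det) (D E) 0 := hd'.comp_hasDerivAt 0 h1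
    have h3 : HasDerivAt (fun t : ℂ => ((1 : CMat n) + t • E).det) E.trace 0 := by
      set q : Polynomial ℂ := (Matrix.det (1 + (Polynomial.X : Polynomial ℂ) • E.map Polynomial.C)).divX.divX with hq
      have e : (fun t : ℂ => ((1 : CMat n) + t • E).det) = fun t =>
          Polynomial.eval t (1 + Polynomial.C E.trace * Polynomial.X + q * Polynomial.X ^ 2) := by
        funext t
        have := Matrix.det_one_add_smul t E
        simp only [Polynomial.eval_add, Polynomial.eval_mul, Polynomial.eval_one, Polynomial.eval_C,
          Polynomial.eval_X, Polynomial.eval_pow]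
        exact this
      rw [e]
      have h4 := (1 + Polynomial.C E.trace * Polynomial.X + q * Polynomial.X ^ 2).hasDerivAt 0
      have h5 : Polynomial.eval 0 (Polynomial.derivative
          (1 + Polynomial.C E.trace * Polynomial.X + q * Polynomial.X ^ 2)) = E.trace := by
        simp
      rw [h5] at h4
      exact h4
    exact h2.unique h3
  have := hasFDerivAt_iff_isLittleO_nhds_zero.1 hd
  refine this.congr_left fun E => ?_
  rw [← hDt E]
  simp only [Matrix.det_one]
  rfl

theorem det_const {T : ℝ} {A g : ℝ → CMat n} {K : ℝ}
    (hA : ∀ t ∈ Set.Icc 0 T, ‖A t‖ ≤ K) (hAtr : ∀ t, (A t).trace = 0)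
    (hg : ∀ t ∈ Set.Icc 0 T, g t ∈ Matrix.unitaryGroup (Fin n) ℂ)
    (hintg : @IntervalIntegrable (Matrix (Fin n) (Fin n) ℂ)
        Matrix.normedAddCommGroup.toPseudoMetricSpace.toUniformSpace.toTopologicalSpace _
        (fun s => A s * g s) volume 0 T)
    (heq : ∀ t ∈ Set.Icc 0 T, g t = g 0 + ∫ s in (0:ℝ)..t, A s * g s) :
    ∀ t ∈ Set.Icc 0 T, (g t).det = (g 0).det := by
  have hsubint : ∀ s t, s ∈ Set.Icc 0 T → t ∈ Set.Icc 0 T → 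
      @IntervalIntegrable (Matrix (Fin n) (Fin n) ℂ)
        Matrix.normedAddCommGroup.toPseudoMetricSpace.toUniformSpace.toTopologicalSpace _
        (fun s => A s * g s) volume s t := by
    intro s t hs ht
    refine hintg.mono_set ?_
    rw [Set.uIcc_of_le (hs.1.trans hs.2)]
    exact Set.uIcc_subset_Icc hs ht
  have hdiff : ∀ s t, s ∈ Set.Icc 0 T → t ∈ Set.Icc 0 T → g t - g s = ∫ r in s..t, A r * g r := by
    intro s t hs ht
    have h0 : (0:ℝ) ∈ Set.Icc 0 T := ⟨le_rfl, hs.1.trans hs.2⟩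
    rw [← intervalIntegral.integral_interval_sub_left (hsubint 0 t h0 ht) (hsubint 0 s h0 hs),
      heq t ht, heq s hs]
    abel
  have hlip : ∀ s t, s ∈ Set.Icc 0 T → t ∈ Set.Icc 0 T → s ≤ t → ‖g t - g s‖ ≤ n * K * (t - s) := by
    intro s t hs ht hst
    rw [hdiff s t hs ht]
    have := intervalIntegral.norm_integral_le_of_norm_le_const (a := s) (b := t) (C := n * K)
      (f := fun r => A r * g r) (fun r hr => by
        rw [Set.uIoc_of_le hst] at hr
        have hr' : r ∈ Set.Icc 0 T := ⟨hs.1.trans hr.1.le, hr.2.trans ht.2⟩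
        have hK := (norm_nonneg _).trans (hA r hr')
        calc ‖A r * g r‖ ≤ n * ‖A r‖ * ‖g r‖ := norm_mul_sup _ _
          _ ≤ n * K * 1 := by
            gcongr
            · exact hA r hr'
            · exact norm_unitary_sup (hg r hr')
          _ = n * K := mul_one _)
    rwa [abs_of_nonneg (by linarith)] at this
  have hstep : ∀ s ∈ Set.Ico 0 T, HasDerivWithinAt (fun t => (g t).det) 0 (Set.Ici s) s := by
    intro s hs
    have hs' : s ∈ Set.Icc 0 T := ⟨hs.1, hs.2.le⟩
    have hK0 := (norm_nonneg _).trans (hA s hs')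
    have hgs := hg s hs'
    have hgs1 := Matrix.mem_unitaryGroup_iff.1 hgs
    have hgs2 := Matrix.mem_unitaryGroup_iff'.1 hgs
    have hsn : ‖star (g s)‖ ≤ 1 := norm_unitary_sup (Unitary.star_mem hgs)
    have hev : ∀ᶠ t in 𝓝[≥] s, t ∈ Set.Icc s T := by
      have : Set.Iio T ∈ 𝓝 s := Iio_mem_nhds hs.2
      filter_upwards [self_mem_nhdsWithin, nhdsWithin_le_nhds this] with t h1 h2
      exact ⟨h1, h2.le⟩
    let e : ℝ → CMat n := fun t => (g t - g s) * star (g s)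
    have he : ∀ t ∈ Set.Icc s T, ‖e t‖ ≤ n * (n * K) * ‖t - s‖ := by
      intro t ht
      have ht' : t ∈ Set.Icc 0 T := ⟨hs.1.trans ht.1, ht.2⟩
      calc ‖e t‖ ≤ n * ‖g t - g s‖ * ‖star (g s)‖ := norm_mul_sup _ _
        _ ≤ n * (n * K * (t - s)) * 1 := by
          gcongr
          · have := ht.1; have : 0 ≤ t - s := by linarith
            positivity
          · exact hlip s t hs' ht' ht.1
        _ = n * (n * K) * ‖t - s‖ := by
          rw [Real.norm_of_nonneg (by linarith [ht.1])]; ring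
    have heO : e =O[𝓝[≥] s] (fun t => t - s) :=
      Asymptotics.IsBigO.of_bound _ (by filter_upwards [hev] with t ht using he t ht)
    have htr : ∀ t ∈ Set.Icc s T, ‖(e t).trace‖ ≤ n * (n * K * (n * (n * K))) * ‖(t - s) ^ 2‖ := by
      intro t ht
      have ht' : t ∈ Set.Icc 0 T := ⟨hs.1.trans ht.1, ht.2⟩
      have hts : 0 ≤ t - s := by linarith [ht.1]
      let L : CMat n →ₗ[ℝ] ℂ :=
        { toFun := fun X => (X * star (g s)).trace
          map_add' := fun X Y => by rw [add_mul, Matrix.trace_add]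
          map_smul' := fun c X => by simp [Matrix.trace_smul] }
      have hL : (e t).trace = ∫ r in s..t, L (A r * g r) := by
        have := (LinearMap.toContinuousLinearMap L).intervalIntegral_comp_comm (hsubint s t hs' ht')
        show L (g t - g s) = _
        rw [hdiff s t hs' ht']
        exact this.symm
      rw [hL]
      have hb := intervalIntegral.norm_integral_le_of_norm_le_const (a := s) (b := t)
        (C := n * (n * K * (n * (n * K) * (t - s))))
        (f := fun r => L (A r * g r)) (fun r hr => by
          rw [Set.uIoc_of_le ht.1] at hr
          have hr1 : r ∈ Set.Icc s T := ⟨hr.1.le, hr.2.trans ht.2⟩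
          have hr' : r ∈ Set.Icc 0 T := ⟨hs.1.trans hr.1.le, hr.2.trans ht.2⟩
          have e1 : L (A r * g r) = (A r * e r).trace := by
            show (A r * g r * star (g s)).trace = (A r * ((g r - g s) * star (g s))).trace
            rw [sub_mul, hgs1, mul_sub, mul_one, Matrix.trace_sub, hAtr, sub_zero, mul_assoc]
          rw [e1]
          calc ‖(A r * e r).trace‖ ≤ n * ‖A r * e r‖ := norm_trace_sup _
            _ ≤ n * (n * ‖A r‖ * ‖e r‖) := by gcongr; exact norm_mul_sup _ _
            _ ≤ n * (n * K * (n * (n * K) * (t - s))) := by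
              gcongr
              · exact hA r hr'
              · refine (he r hr1).trans ?_
                rw [Real.norm_of_nonneg (by linarith [hr.1])]
                gcongr
                exact hr.2)
      rw [abs_of_nonneg hts] at hb
      refine hb.trans (le_of_eq ?_)
      rw [Real.norm_of_nonneg (by positivity)]
      ring
    have htO : (fun t => (e t).trace) =O[𝓝[≥] s] (fun t => (t - s) ^ 2) :=
      Asymptotics.IsBigO.of_bound _ (by filter_upwards [hev] with t ht using htr t ht)
    have hts0 : Tendsto (fun t => t - s) (𝓝[≥] s) (𝓝 0) := by
      have hc : Continuous (fun t : ℝ => t - s) := by fun_prop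
      have := hc.tendsto s
      rw [sub_self] at this
      exact this.mono_left nhdsWithin_le_nhds
    have hsq : (fun t => (t - s) ^ 2) =o[𝓝[≥] s] (fun t => t - s) := by
      have h1 : (fun x : ℝ => x ^ 2) =o[𝓝 0] (fun x : ℝ => x) := by
        have := Asymptotics.isLittleO_pow_pow (𝕜 := ℝ) (m := 1) (n := 2) (by norm_num)
        simpa using this
      exact h1.comp_tendsto hts0
    have he0 : Tendsto e (𝓝[≥] s) (𝓝 0) := heO.trans_tendsto hts0
    have hdet : (fun t => (1 + e t).det - 1 - (e t).trace) =o[𝓝[≥] s] (fun t => t - s) :=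
      (det_littleO.comp_tendsto he0).trans_isBigO heO
    have hdet2 : (fun t => (1 + e t).det - 1) =o[𝓝[≥] s] (fun t => t - s) := by
      have := hdet.add (htO.trans_isLittleO hsq)
      refine this.congr_left fun t => ?_
      ring
    rw [hasDerivWithinAt_iff_isLittleO]
    have := hdet2.const_mul_left (g s).det
    refine this.congr_left fun t => ?_
    have e2 : g t = (1 + e t) * g s := by
      show g t = (1 + (g t - g s) * star (g s)) * g s
      rw [add_mul, mul_assoc, hgs2, one_mul, mul_one, add_sub_cancel]
    have e3 : (g t).det = (1 + e t).det * (g s).det := by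
      rw [← Matrix.det_mul, ← e2]
    rw [e3]
    simp
    ring
  have hcont : ContinuousOn (fun t => (g t).det) (Set.Icc 0 T) := by
    have hgc : ContinuousOn g (Set.Icc 0 T) := by
      have hl : LipschitzOnWith (Real.toNNReal (n * K)) g (Set.Icc 0 T) := by
        refine LipschitzOnWith.of_dist_le_mul fun x hx y hy => ?_
        have hK0 := (norm_nonneg _).trans (hA x hx)
        rw [Real.coe_toNNReal _ (by positivity)]
        rcases le_total x y with h | h
        · rw [dist_comm, dist_eq_norm, dist_comm, Real.dist_eq, abs_of_nonneg (by linarith)]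
          exact hlip x y hx hy h
        · rw [dist_eq_norm, Real.dist_eq, abs_of_nonneg (by linarith)]
          exact hlip y x hy hx h
      exact hl.continuousOn
    exact det_differentiable.continuous.comp_continuousOn hgc
  exact constant_of_has_deriv_right_zero hcont hstep

theorem traj_det (htr0 : H0.trace = 0) (htrc : ∀ i, (Hc i).trace = 0) {T : ℝ}
    {u : ℝ → EuclideanSpace ℝ (Fin m)} {g : ℝ → CMat n}
    (hu : IsAdmissibleControl U T u) (hg : IsLiftedTrajectory (controlHam H0 Hc) T u g) :
    ∀ t ∈ Set.Icc 0 T, (g t).det = (g 0).det := by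
  obtain ⟨-, -, C, hC⟩ := hu
  obtain ⟨h1, h2, h3⟩ := hg
  obtain ⟨K, hK⟩ := ((isCompact_closedBall (0 : EuclideanSpace ℝ (Fin m)) C).exists_bound_of_continuousOn
    (f := fun v => (-Complex.I) • controlHam H0 Hc v)
    ((controlHam_cont (H0 := H0) (Hc := Hc)).const_smul (-Complex.I)).continuousOn)
  refine det_const (A := fun t => (-Complex.I) • controlHam H0 Hc (u t)) (K := K) ?_ ?_ h1 ?_ ?_
  · intro t ht
    exact hK (u t) (by rw [mem_closedBall_zero_iff]; exact hC t ht)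
  · intro t
    simp [controlHam, Matrix.trace_sum, htr0, htrc]
  · simp only [Matrix.smul_mul]; exact h2
  · simp only [Matrix.smul_mul]; exact h3

end DetPres

end

/-- from Theorem 2.8 of the paper. If `H0, …, Hm` are traceless and
the spectrum of the control-affine Hamiltonian `H(·)` is conically connected, then the
lifted system `i·ġ = H(u)·g` leaves the special unitary group `SU(n)` invariant and is
exactly controllable in `SU(n)`. -/
theorem conically_connected_exact_controllability_special_unitary {n m : ℕ} (hn : 2 ≤ n)
    (hm : 2 ≤ m)
    (U : Set (EuclideanSpace ℝ (Fin m))) (hUopen : IsOpen U) (hUconn : IsConnected U)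
    (H0 : Matrix (Fin n) (Fin n) ℂ) (Hc : Fin m → Matrix (Fin n) (Fin n) ℂ)
    (hH0 : H0.IsHermitian) (hHc : ∀ i, (Hc i).IsHermitian)
    (htr0 : H0.trace = 0) (htrc : ∀ i, (Hc i).trace = 0)
    (lam : EuclideanSpace ℝ (Fin m) → Fin n → ℝ)
    (hlam : IsOrderedSpectrum H0 Hc U lam)
    (hcc : ConicallyConnected U lam) :
    (∀ (T : ℝ) (u : ℝ → EuclideanSpace ℝ (Fin m)) (g : ℝ → Matrix (Fin n) (Fin n) ℂ),
      0 ≤ T → IsAdmissibleControl U T u → IsLiftedTrajectory (controlHam H0 Hc) T u g →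
      g 0 ∈ Matrix.specialUnitaryGroup (Fin n) ℂ →
      ∀ t ∈ Set.Icc 0 T, g t ∈ Matrix.specialUnitaryGroup (Fin n) ℂ) ∧
    ∀ g0 ∈ Matrix.specialUnitaryGroup (Fin n) ℂ,
      liftedReachable U (controlHam H0 Hc) g0 =
        (Matrix.specialUnitaryGroup (Fin n) ℂ : Set (Matrix (Fin n) (Fin n) ℂ)) := by
  have hinv : ∀ (T : ℝ) (u : ℝ → EuclideanSpace ℝ (Fin m)) (g : ℝ → Matrix (Fin n) (Fin n) ℂ),
      0 ≤ T → IsAdmissibleControl U T u → IsLiftedTrajectory (controlHam H0 Hc) T u g →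
      g 0 ∈ Matrix.specialUnitaryGroup (Fin n) ℂ →
      ∀ t ∈ Set.Icc 0 T, g t ∈ Matrix.specialUnitaryGroup (Fin n) ℂ := by
    intro T u g hT hu hg h0 t ht
    rw [Matrix.mem_specialUnitaryGroup_iff] at h0 ⊢
    exact ⟨hg.1 t ht, (traj_det htr0 htrc hu hg t ht).trans h0.2⟩
  refine ⟨hinv, fun g0 hg0 => Set.Subset.antisymm ?_ ?_⟩
  · rintro g1 ⟨T, hT, u, g, hu, hg, h0, h1⟩
    rw [← h1]
    exact hinv T u g hT hu hg (by rw [h0]; exact hg0) T ⟨hT, le_rfl⟩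
  · intro g1 hg1
    have hg0' := Matrix.mem_specialUnitaryGroup_iff.1 hg0
    have hg1' := Matrix.mem_specialUnitaryGroup_iff.1 hg1
    have hs : g1 * star g0 ∈ Matrix.specialUnitaryGroup (Fin n) ℂ := by
      rw [Matrix.mem_specialUnitaryGroup_iff]
      refine ⟨mul_mem hg1'.1 (Unitary.star_mem hg0'.1), ?_⟩
      rw [Matrix.det_mul, hg1'.2, Matrix.star_eq_conjTranspose, Matrix.det_conjTranspose, hg0'.2]
      simp
    have hc : g1 * star g0 ∈ ctlS (gens H0 Hc U) := by
      refine special_sub (by omega) (gens_skew hH0 hHc) ?_ ?_ hs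
      · rintro X ⟨u, -, rfl⟩
        simp [controlHam, Matrix.trace_sum, htr0, htrc]
      · intro Y hY hYtr
        exact hfull_main hn hm hH0 hHc hUopen hUconn hlam hcc Y hY hYtr
    have hr := reach_all hH0 hHc hg0'.1 hUconn.nonempty hc
    rwa [mul_assoc, Matrix.mem_unitaryGroup_iff'.1 hg0'.1, mul_one] at hr
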